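/- arXiv:1601.04807 — 12 statements merged into one kernel-verified Lean document; each statement's English description precedes it below -/
import Mathlib

section
/- Let N, q, t, w_1, ..., w_t be positive integers with q ≥ t ≥ 2, let u = w_1 + ... + w_t, and let r be the integer with 1 ≤ r ≤ u-1 and N ≡ r (mod u-1). Suppose an SHF(N;n,q,{w_1,...,w_t}) exists and C(⌊N/(u-1)⌋, q, {w_1,...,w_t}) ≥ u. Then n ≤ r·q^{⌈N/(u-1)⌉} + (u-1-r)·q^{⌊N/(u-1)⌋}. -/
/-- A function `f` separates the pairwise disjoint sets `C 1, ..., C t` if the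
images `f (C i)` are pairwise disjoint. -/
def Separates {n q t : ℕ} (f : Fin n → Fin q) (C : Fin t → Finset (Fin n)) : Prop :=
  ∀ i j : Fin t, i ≠ j → ∀ x ∈ C i, ∀ y ∈ C j, f x ≠ f y

/-- `F` is an `SHF(N; n, q, {w 1, ..., w t})`: a family of `N` functions from an
`n`-set to a `q`-set such that every family of pairwise disjoint subsets of sizes
`w 1, ..., w t` is separated by at least one function. -/
def IsSHF {t : ℕ} (N n q : ℕ) (w : Fin t → ℕ) (F : Fin N → Fin n → Fin q) : Prop :=
  ∀ C : Fin t → Finset (Fin n),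
    (∀ i j : Fin t, i ≠ j → Disjoint (C i) (C j)) →
    (∀ i : Fin t, (C i).card = w i) →
    ∃ f : Fin N, Separates (F f) C

/-- `C(N, q, {w 1, ..., w t})`: the maximal `n` for which an
`SHF(N; n, q, {w 1, ..., w t})` exists. -/
noncomputable def maxSHF (N q : ℕ) {t : ℕ} (w : Fin t → ℕ) : ℕ :=
  sSup {n | ∃ F : Fin N → Fin n → Fin q, IsSHF N n q w F}

lemma blocks_aux {t N n q : ℕ} (F : Fin N → Fin n → Fin q) (b : Fin N → ℕ)
    (c : ℕ → Fin t) (h01 : c 0 ≠ c 1) : ∀ (k : ℕ) (X : Finset (Fin n)),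
    ∑ j ∈ Finset.range k, q ^ (Fintype.card {f // b f = j}) < X.card →
    ∃ x : ℕ → Fin n, (∀ i ≤ k, ∀ j ≤ k, x i = x j → i = j) ∧ (∀ i ≤ k, x i ∈ X) ∧
      ∀ j < k, ∃ i ≤ k, ∃ l ≤ k, c i ≠ c l ∧ ∀ f, b f = j → F f (x i) = F f (x l) := by
  intro k
  induction k with
  | zero =>
    intro X hX
    obtain ⟨v, hv⟩ := Finset.card_pos.1 (by simpa using hX)
    exact ⟨fun _ => v, by intros; omega, fun _ _ => hv, by intros; omega⟩
  | succ k ih =>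
    intro X hX
    classical
    let p : Fin n → ({f // b f = k} → Fin q) := fun v f => F f.1 v
    have hex : ∀ y ∈ X.image p, ∃ v, v ∈ X ∧ p v = y := by
      intro y hy
      simpa using hy
    obtain ⟨v0, -⟩ : X.Nonempty := Finset.card_pos.1 (by omega)
    haveI : Nonempty (Fin n) := ⟨v0⟩
    choose! g hg1 hg2 using hex
    let R := (X.image p).image g
    have hR : R.card ≤ q ^ (Fintype.card {f // b f = k}) := by
      refine Finset.card_image_le.trans ((Finset.card_le_univ _).trans ?_)
      simp
    have hRX : X.card - R.card ≤ (X \ R).card := Finset.le_card_sdiff _ _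
    rw [Finset.sum_range_succ] at hX
    obtain ⟨x, hx1, hx2, hx3⟩ := ih (X \ R) (by omega)
    -- an index whose colour differs from that of the new point
    obtain ⟨i, hi, hci⟩ : ∃ i ≤ k, c i ≠ c (k + 1) := by
      by_cases h0 : c 0 = c (k + 1)
      · refine ⟨1, ?_, fun h => h01 (h0.trans h.symm)⟩
        rcases Nat.eq_zero_or_pos k with rfl | h
        · exact absurd h0 h01
        · exact h
      · exact ⟨0, Nat.zero_le _, h0⟩
    have hiX : x i ∈ X := (Finset.mem_sdiff.1 (hx2 i hi)).1
    have hpi : p (x i) ∈ X.image p := Finset.mem_image_of_mem _ hiX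
    set v := g (p (x i)) with hv
    have hvR : v ∈ R := Finset.mem_image_of_mem _ hpi
    have hvX : v ∈ X := hg1 _ hpi
    have hne : ∀ a ≤ k, x a ≠ v := fun a ha h =>
      (Finset.mem_sdiff.1 (hx2 a ha)).2 (h ▸ hvR)
    refine ⟨fun a => if a ≤ k then x a else v, ?_, ?_, ?_⟩
    · intro a ha a' ha' h
      by_cases h1 : a ≤ k <;> by_cases h2 : a' ≤ k <;> simp only [h1, h2, if_true, if_false] at h
      · exact hx1 a h1 a' h2 h
      · exact absurd h (hne a h1)
      · exact absurd h.symm (hne a' h2)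
      · omega
    · intro a ha
      by_cases h1 : a ≤ k <;> simp only [h1, if_true, if_false]
      · exact (Finset.mem_sdiff.1 (hx2 a h1)).1
      · exact hvX
    · intro j hj
      rcases Nat.lt_succ_iff_lt_or_eq.1 hj with hj | rfl
      · obtain ⟨a, ha, l, hl, hc, hf⟩ := hx3 j hj
        refine ⟨a, by omega, l, by omega, hc, ?_⟩
        simpa [ha, hl] using hf
      · refine ⟨i, by omega, j + 1, le_rfl, hci, ?_⟩
        intro f hf
        have := congrFun (hg2 _ hpi) ⟨f, hf⟩
        simpa [hi, p] using this.symm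

lemma colour_aux {t : ℕ} (ht : 2 ≤ t) (w : Fin t → ℕ) (hw : ∀ i, 1 ≤ w i) (m : ℕ)
    (hu : m + 1 = ∑ i, w i) (hm : 1 ≤ m) : ∃ c : ℕ → Fin t, c 0 ≠ c 1 ∧
      ∀ i, ((Finset.range (m + 1)).filter (fun a => c a = i)).card = w i := by
  classical
  let A := Σ i : Fin t, Fin (w i)
  have hcard : Fintype.card (Fin (m + 1)) = Fintype.card A := by simp [A, hu]
  let e0 : Fin (m + 1) ≃ A := Fintype.equivOfCardEq hcard
  let p0 : A := ⟨⟨0, by omega⟩, ⟨0, hw _⟩⟩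
  let p1 : A := ⟨⟨1, by omega⟩, ⟨0, hw _⟩⟩
  have hp : p0.1 ≠ p1.1 := by simp [p0, p1]
  have hp' : p0 ≠ p1 := fun h => hp (by rw [h])
  let z : Fin (m + 1) := ⟨0, by omega⟩
  let o : Fin (m + 1) := ⟨1, by omega⟩
  have hzo : z ≠ o := by simp [z, o]
  let e1 : Fin (m + 1) ≃ A := e0.trans (Equiv.swap (e0 z) p0)
  have h1 : e1 z = p0 := by simp [e1]
  let e2 : Fin (m + 1) ≃ A := e1.trans (Equiv.swap (e1 o) p1)
  have h2 : e2 o = p1 := by simp [e2]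
  have h3 : e2 z = p0 := by
    have : p0 ≠ e1 o := by rw [← h1]; exact fun h => hzo (e1.injective h)
    simp only [e2, Equiv.trans_apply, h1]
    exact Equiv.swap_apply_of_ne_of_ne this hp'
  refine ⟨fun a => if h : a < m + 1 then (e2 ⟨a, h⟩).1 else p0.1, ?_, ?_⟩
  · have ha : (0 : ℕ) < m + 1 := by omega
    have hb : 1 < m + 1 := by omega
    simp only [ha, hb, dif_pos]
    change (e2 z).1 ≠ (e2 o).1
    rw [h2, h3]; exact hp
  · intro i
    have : Finset.card (Finset.univ : Finset (Fin (w i))) = w i := by simp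
    rw [← this]
    symm
    refine Finset.card_bij (fun s _ => ((e2.symm ⟨i, s⟩ : Fin (m + 1)) : ℕ)) ?_ ?_ ?_
    · intro s _
      have hlt := (e2.symm ⟨i, s⟩).isLt
      rw [Finset.mem_filter, Finset.mem_range]
      refine ⟨hlt, ?_⟩
      beta_reduce
      rw [dif_pos hlt]
      simp
    · intro s _ s' _ h
      have := e2.symm.injective (Fin.ext h)
      exact eq_of_heq (Sigma.mk.inj this).2
    · intro a ha
      simp only [Finset.mem_filter, Finset.mem_range] at ha
      obtain ⟨h, ha⟩ := ha
      rw [dif_pos h] at ha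
      subst ha
      exact ⟨(e2 ⟨a, h⟩).2, Finset.mem_univ _, by simp⟩

lemma block_card (N m j : ℕ) (hm : 0 < m) (hj : j < m) :
    Fintype.card {f : Fin N // f.val % m = j} = N / m + if j < N % m then 1 else 0 := by
  have h := Nat.count_modEq_card N hm j
  rw [Nat.mod_eq_of_lt hj] at h
  rw [← h, Nat.count_eq_card_filter_range, Fintype.card_subtype]
  refine Finset.card_bij (fun a _ => a.val) ?_ ?_ ?_
  · intro a ha
    simpa [Nat.ModEq, Nat.mod_eq_of_lt hj] using ha
  · intro a _ b _ h
    exact Fin.ext h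
  · intro a ha
    simp only [Finset.mem_filter, Finset.mem_range, Nat.ModEq, Nat.mod_eq_of_lt hj] at ha
    exact ⟨⟨a, ha.1⟩, by simpa using ha.2, rfl⟩

lemma sum_aux (q d s m : ℕ) (hs : s ≤ m) :
    ∑ j ∈ Finset.range m, q ^ (d + if j < s then 1 else 0)
      = s * q ^ (d + 1) + (m - s) * q ^ d := by
  obtain ⟨e, rfl⟩ := Nat.exists_eq_add_of_le hs
  rw [Finset.sum_range_add]
  congr 1
  · rw [Finset.sum_congr rfl (g := fun _ => q ^ (d + 1))]
    · simp
    · intro j hj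
      simp [Finset.mem_range.1 hj]
  · simp

theorem stmt_0 {t : ℕ} (ht : 2 ≤ t) (N n q : ℕ) (hN : 1 ≤ N) (hq : t ≤ q)
    (w : Fin t → ℕ) (hw : ∀ i, 1 ≤ w i) (u : ℕ) (hu : u = ∑ i, w i)
    (r : ℕ) (hr1 : 1 ≤ r) (hr2 : r ≤ u - 1) (hmod : N % (u - 1) = r % (u - 1))
    (F : Fin N → Fin n → Fin q) (hF : IsSHF N n q w F)
    (hC : u ≤ maxSHF (N / (u - 1)) q w) :
    n ≤ r * q ^ ((N + (u - 1) - 1) / (u - 1)) + (u - 1 - r) * q ^ (N / (u - 1)) := by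
  classical
  clear hC
  obtain ⟨m, rfl⟩ : ∃ m, u = m + 1 := ⟨u - 1, by omega⟩
  simp only [Nat.add_sub_cancel] at *
  have hm : 0 < m := by omega
  have hsum : ∑ j ∈ Finset.range m, q ^ (Fintype.card {f : Fin N // f.val % m = j})
      = r * q ^ ((N + m - 1) / m) + (m - r) * q ^ (N / m) := by
    rw [Finset.sum_congr rfl (fun j hj => by
      rw [block_card N m j hm (Finset.mem_range.1 hj)]), sum_aux _ _ _ _ (Nat.mod_lt N hm).le]
    have hdiv := Nat.div_add_mod N m
    rcases Nat.lt_or_eq_of_le hr2 with h | h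
    · rw [Nat.mod_eq_of_lt h] at hmod
      have : (N + m - 1) / m = N / m + 1 := by
        rw [← Nat.add_div_right _ hm] 
        rw [Nat.div_eq_iff hm] 
        have h2 : (N + m) / m = N / m + 1 := Nat.add_div_right _ hm
        rw [h2, Nat.add_mul, Nat.mul_comm (N / m) m]
        omega
      rw [this, hmod]
    · subst h
      rw [Nat.mod_self] at hmod
      have : (N + r - 1) / r = N / r := by
        rw [Nat.div_eq_iff hm, Nat.mul_comm (N / r) r]
        omega
      rw [this, hmod]
      simp
  rw [← hsum]
  by_contra hlt
  push Not at hlt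
  obtain ⟨c, h01, hc⟩ := colour_aux ht w hw m hu hm
  obtain ⟨x, hx1, -, hx3⟩ := blocks_aux F (fun f => f.val % m) c h01 m Finset.univ
    (by simpa using hlt)
  obtain ⟨f, hf⟩ := hF
    (fun i => ((Finset.range (m + 1)).filter (fun a => c a = i)).image x) (by
      intro i j hij
      rw [Finset.disjoint_left]
      intro y hy hy'
      simp only [Finset.mem_image, Finset.mem_filter, Finset.mem_range] at hy hy'
      obtain ⟨a, ⟨ha, hca⟩, rfl⟩ := hy
      obtain ⟨a', ⟨ha', hca'⟩, h⟩ := hy'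
      have := hx1 a' (by omega) a (by omega) h
      subst this
      exact hij (hca.symm.trans hca')) (by
      intro i
      rw [← hc i]
      refine Finset.card_image_of_injOn ?_
      intro a ha a' ha' h
      simp only [Finset.coe_filter, Finset.mem_range, Set.mem_setOf_eq] at ha ha'
      exact hx1 a (by omega) a' (by omega) h)
  obtain ⟨i, hi, l, hl, hcil, hfe⟩ := hx3 (f.val % m) (Nat.mod_lt _ hm)
  refine hf (c i) (c l) hcil (x i) ?_ (x l) ?_ (hfe f rfl)
  · exact Finset.mem_image_of_mem _ (by simp; omega)
  · exact Finset.mem_image_of_mem _ (by simp; omega)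
end

section
/- For all integers q ≥ 2 and N ≥ 2, there exists a PHF(N; N·q^{N-1}, q^{N-1} + (N-1)·q^{N-2}, N+1), i.e., an (N+1)-perfect hash family consisting of N functions from a set of size N·q^{N-1} to a set of size q^{N-1} + (N-1)·q^{N-2}. -/
/-- `F` is a `PHF(N; n, q, t)` (a `t`-perfect hash family): a family of `N`
functions from an `n`-set to a `q`-set such that every `t`-element subset of the
domain is mapped injectively by at least one of the functions. -/
def IsPHF (N n q t : ℕ) (F : Fin N → Fin n → Fin q) : Prop :=
  ∀ C : Finset (Fin n), C.card = t → ∃ i : Fin N, Set.InjOn (F i) ↑C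

open Classical in
/-- A finite nonempty set of vectors has more points than directions of its Hamming edges. -/
lemma card_dir {ι α : Type*} [DecidableEq ι] (D : Finset ι) :
    ∀ S : Finset (ι → α), S.Nonempty →
      (∀ i ∈ D, ∃ x ∈ S, ∃ y ∈ S, x ≠ y ∧ ∀ k, k ≠ i → x k = y k) →
      D.card + 1 ≤ S.card := by
  induction D using Finset.induction_on with
  | empty =>
    intro S hS _
    simpa using hS.card_pos
  | insert i D hi ih =>
    intro S hS h
    obtain ⟨x, hx, y, hy, hxy, hag⟩ := h i (Finset.mem_insert_self _ _)
    set p : (ι → α) → (ι → α) := fun v => Function.update v i (x i) with hp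
    have hpxy : p x = p y := by
      funext k
      by_cases hk : k = i
      · subst hk; simp [hp]
      · simp [hp, hk, hag k hk]
    have hlt : (S.image p).card < S.card := by
      refine lt_of_le_of_ne Finset.card_image_le ?_
      intro he
      exact hxy (Finset.card_image_iff.mp he hx hy hpxy)
    have := ih (S.image p) (hS.image p) (by
      intro k hk
      have hki : k ≠ i := fun e => hi (e ▸ hk)
      obtain ⟨a, ha, b, hb, hab, hag2⟩ := h k (Finset.mem_insert_of_mem hk)
      refine ⟨p a, Finset.mem_image_of_mem _ ha, p b, Finset.mem_image_of_mem _ hb, ?_, ?_⟩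
      · intro e
        apply hab
        funext l
        by_cases hl : l = k
        · subst hl
          have := congrFun e l
          simpa [hp, hki] using this
        · exact hag2 l hl
      · intro l hl
        by_cases hli : l = i
        · subst hli; simp [hp]
        · simp [hp, hli, hag2 l hl])
    rw [Finset.card_insert_of_notMem hi]
    omega

/-- The hash functions. -/
def hashF (K q : ℕ) (i : Fin (K + 2)) (p : Fin (K + 2) × (Fin (K + 1) → Fin q)) :
    (Fin (K + 1) → Fin q) ⊕ (Fin (K + 1) × (Fin K → Fin q)) :=
  match finSuccEquiv' i p.1, finSuccEquiv' p.1 i with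
  | some a, some b => Sum.inr (a, b.removeNth p.2)
  | _, _ => Sum.inl p.2

lemma hashF_self (K q : ℕ) (i : Fin (K + 2)) (v : Fin (K + 1) → Fin q) :
    hashF K q i (i, v) = Sum.inl v := by
  simp [hashF]

lemma hashF_ne (K q : ℕ) (i j : Fin (K + 2)) (a b : Fin (K + 1)) (ha : i.succAbove a = j)
    (hb : j.succAbove b = i) (v : Fin (K + 1) → Fin q) :
    hashF K q i (j, v) = Sum.inr (a, b.removeNth v) := by
  have h1 : finSuccEquiv' i j = some a := by rw [← ha]; simp
  have h2 : finSuccEquiv' j i = some b := by rw [← hb]; simp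
  simp [hashF, h1, h2]

/-- Collisions only happen along Hamming edges. -/
lemma hashF_coll (K q : ℕ) (i : Fin (K + 2)) (x y : Fin (K + 2) × (Fin (K + 1) → Fin q))
    (hxy : x ≠ y) (h : hashF K q i x = hashF K q i y) :
    ∃ b : Fin (K + 1), x.1 = y.1 ∧ x.1.succAbove b = i ∧ x.2 ≠ y.2 ∧
      ∀ k, k ≠ b → x.2 k = y.2 k := by
  obtain ⟨j, v⟩ := x
  obtain ⟨l, w⟩ := y
  by_cases hj : j = i
  · subst hj
    by_cases hl : l = j
    · subst hl
      rw [hashF_self, hashF_self] at h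
      simp at h
      subst h
      exact absurd rfl hxy
    · obtain ⟨a, ha⟩ := Fin.exists_succAbove_eq hl
      obtain ⟨b, hb⟩ := Fin.exists_succAbove_eq (Ne.symm hl)
      rw [hashF_self, hashF_ne K q j l a b ha hb] at h
      simp at h
  · obtain ⟨a, ha⟩ := Fin.exists_succAbove_eq hj
    obtain ⟨b, hb⟩ := Fin.exists_succAbove_eq (Ne.symm hj)
    rw [hashF_ne K q i j a b ha hb] at h
    by_cases hl : l = i
    · subst hl
      rw [hashF_self] at h
      simp at h
    · obtain ⟨a', ha'⟩ := Fin.exists_succAbove_eq hl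
      obtain ⟨b', hb'⟩ := Fin.exists_succAbove_eq (Ne.symm hl)
      rw [hashF_ne K q i l a' b' ha' hb'] at h
      simp only [Sum.inr.injEq, Prod.mk.injEq] at h
      obtain ⟨h1, h2⟩ := h
      have hjl : j = l := by rw [← ha, ← ha', h1]
      subst hjl
      have hbb : b = b' := Fin.succAbove_right_injective (hb.trans hb'.symm)
      subst hbb
      refine ⟨b, rfl, hb, ?_, ?_⟩
      · intro e
        apply hxy
        simpa using e
      · intro k hk
        obtain ⟨c, hc⟩ := Fin.exists_succAbove_eq hk
        have := congrFun h2 c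
        simpa [Fin.removeNth, hc] using this

open Classical in
lemma hashF_perfect (K q : ℕ) (C : Finset (Fin (K + 2) × (Fin (K + 1) → Fin q)))
    (hC : C.card = K + 3) : ∃ i, Set.InjOn (hashF K q i) (C : Set _) := by
  by_contra hcon
  push Not at hcon
  have hcoll : ∀ i : Fin (K + 2), ∃ j : Fin (K + 2), ∃ b : Fin (K + 1), j.succAbove b = i ∧
      ∃ v w, (j, v) ∈ C ∧ (j, w) ∈ C ∧ v ≠ w ∧ ∀ k, k ≠ b → v k = w k := by
    intro i
    have := hcon i
    simp only [Set.InjOn] at this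
    push Not at this
    obtain ⟨x, hx, y, hy, he, hne⟩ := this
    obtain ⟨b, h1, h2, h3, h4⟩ := hashF_coll K q i x y hne he
    obtain ⟨j, v⟩ := x
    obtain ⟨l, w⟩ := y
    simp only at h1
    subst h1
    exact ⟨j, b, h2, v, w, hx, hy, h3, h4⟩
  let S : Fin (K + 2) → Finset (Fin (K + 1) → Fin q) :=
    fun j => Finset.univ.filter fun v => (j, v) ∈ C
  let D : Fin (K + 2) → Finset (Fin (K + 1)) := fun j => Finset.univ.filter fun b =>
    ∃ v w, (j, v) ∈ C ∧ (j, w) ∈ C ∧ v ≠ w ∧ ∀ k, k ≠ b → v k = w k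
  let J : Finset (Fin (K + 2)) := Finset.univ.filter fun j => (S j).Nonempty
  have hS : ∑ j, (S j).card = K + 3 := by
    rw [← hC, ← Finset.card_sigma]
    refine Finset.card_bij (fun z _ => (z.1, z.2)) ?_ ?_ ?_
    · rintro ⟨j, v⟩ h
      simpa [S] using h
    · rintro ⟨j, v⟩ _ ⟨l, w⟩ _ h
      simp only [Prod.mk.injEq] at h
      obtain ⟨rfl, rfl⟩ := h
      rfl
    · rintro ⟨j, v⟩ h
      exact ⟨⟨j, v⟩, by simpa [S] using h, rfl⟩
  have hDS : ∀ j, (D j).card + (if j ∈ J then 1 else 0) ≤ (S j).card := by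
    intro j
    by_cases hj : (S j).Nonempty
    · have hJ : j ∈ J := by simp [J, hj]
      rw [if_pos hJ]
      apply card_dir _ _ hj
      intro b hb
      obtain ⟨v, w, hv, hw, h1, h2⟩ := (Finset.mem_filter.mp hb).2
      exact ⟨v, by simp [S, hv], w, by simp [S, hw], h1, h2⟩
    · have hJ : j ∉ J := by simp [J, hj]
      rw [if_neg hJ]
      have : D j = ∅ := by
        apply Finset.eq_empty_of_forall_notMem
        intro b hb
        obtain ⟨v, w, hv, hw, h1, h2⟩ := (Finset.mem_filter.mp hb).2
        exact hj ⟨v, by simp [S, hv]⟩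
      simp [this]
  have hsum : ∑ j, (D j).card + J.card ≤ K + 3 := by
    rw [← hS]
    calc ∑ j, (D j).card + J.card
        = ∑ j, ((D j).card + (if j ∈ J then 1 else 0)) := by
          rw [Finset.sum_add_distrib]; simp
      _ ≤ _ := Finset.sum_le_sum fun j _ => hDS j
  have hcov : K + 2 ≤ ∑ j, (D j).card := by
    rw [← Finset.card_sigma]
    have : (Finset.univ : Finset (Fin (K + 2))) ⊆
        (Finset.univ.sigma D).image fun z => z.1.succAbove z.2 := by
      intro i _
      obtain ⟨j, b, hb, h⟩ := hcoll i
      exact Finset.mem_image.mpr ⟨⟨j, b⟩, by simpa [D] using h, hb⟩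
    simpa using (Finset.card_le_card this).trans Finset.card_image_le
  have hne : C.Nonempty := Finset.card_pos.mp (by omega)
  obtain ⟨⟨j0, v0⟩, h0⟩ := hne
  obtain ⟨j1, b, hb, v, w, hv, -⟩ := hcoll j0
  have hJ2 : 1 < J.card := by
    refine Finset.one_lt_card.mpr ⟨j0, ?_, j1, ?_, ?_⟩
    · exact Finset.mem_filter.mpr ⟨Finset.mem_univ _, v0, by simp [S, h0]⟩
    · exact Finset.mem_filter.mpr ⟨Finset.mem_univ _, v, by simp [S, hv]⟩
    · rw [← hb]; exact Fin.succAbove_ne _ _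
  omega

theorem stmt_1 (q N : ℕ) (hq : 2 ≤ q) (hN : 2 ≤ N) :
    ∃ F : Fin N → Fin (N * q ^ (N - 1)) → Fin (q ^ (N - 1) + (N - 1) * q ^ (N - 2)),
      IsPHF N (N * q ^ (N - 1)) (q ^ (N - 1) + (N - 1) * q ^ (N - 2)) (N + 1) F := by
  obtain ⟨K, rfl⟩ : ∃ K, N = K + 2 := ⟨N - 2, by omega⟩
  have e1 : Fin ((K + 2) * q ^ (K + 2 - 1)) ≃ Fin (K + 2) × (Fin (K + 1) → Fin q) :=
    Fintype.equivOfCardEq (by simp)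
  have e2 : (Fin (K + 1) → Fin q) ⊕ (Fin (K + 1) × (Fin K → Fin q)) ≃
      Fin (q ^ (K + 2 - 1) + (K + 2 - 1) * q ^ (K + 2 - 2)) :=
    Fintype.equivOfCardEq (by simp)
  refine ⟨fun i x => e2 (hashF K q i (e1 x)), ?_⟩
  intro C hC
  obtain ⟨i, hi⟩ := hashF_perfect K q (C.map e1.toEmbedding) (by simp [hC])
  refine ⟨i, ?_⟩
  intro x hx y hy h
  apply e1.injective
  apply hi
  · simpa using hx
  · simpa using hy
  · exact e2.injective h
end

section
/- For every fixed type {w_1,...,w_t} of positive integers with t ≥ 2 and u = w_1 + ... + w_t, the limit as q → ∞ of C(u-1, q, {w_1,...,w_t})/q equals u-1. In particular, u-1 is the smallest real number γ such that C(u-1, q, {w_1,...,w_t}) ≤ γ·q holds for all q. -/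
theorem exists_reps {α β : Type*} [DecidableEq α] [Fintype β] [DecidableEq β] (f : α → β)
    (A : Finset α) : ∃ R ⊆ A, R.card ≤ Fintype.card β ∧ ∀ a ∈ A, ∃ r ∈ R, f r = f a := by
  have h : ∀ b : {b // b ∈ A.image f}, ∃ a ∈ A, f a = b := fun b => by
    have := b.2
    rwa [Finset.mem_image] at this
  choose g hgA hg using h
  refine ⟨Finset.univ.image g, ?_, ?_, ?_⟩
  · intro x hx
    obtain ⟨b, -, rfl⟩ := Finset.mem_image.1 hx
    exact hgA b
  · refine Finset.card_image_le.trans ?_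
    rw [Finset.card_univ, Fintype.card_coe]
    exact Finset.card_le_univ _
  · intro a ha
    exact ⟨g ⟨f a, Finset.mem_image_of_mem f ha⟩, Finset.mem_image_of_mem _ (Finset.mem_univ _),
      hg _⟩

theorem exists_tree {α β : Type*} [DecidableEq α] [Fintype β] [DecidableEq β] (f : ℕ → α → β)
    (p : ℕ → ℕ) (hp : ∀ j, p (j + 1) ≤ j) : ∀ (k : ℕ) (A : Finset α),
    k * Fintype.card β < A.card → ∃ v : ℕ → α, (∀ i ≤ k, v i ∈ A) ∧
      (∀ i ≤ k, ∀ j ≤ k, v i = v j → i = j) ∧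
      ∀ j < k, f j (v (j + 1)) = f j (v (p (j + 1))) := by
  intro k
  induction k with
  | zero =>
    intro A hA
    obtain ⟨a, ha⟩ := Finset.card_pos.1 (by omega : 0 < A.card)
    refine ⟨fun _ => a, fun _ _ => ha, ?_, ?_⟩
    · intro i hi j hj _
      omega
    · intro j hj
      omega
  | succ k ih =>
    intro A hA
    obtain ⟨R, hRA, hRc, hR⟩ := exists_reps (f k) A
    have hc : (A \ R).card = A.card - R.card := Finset.card_sdiff_of_subset hRA
    have h1 : k * Fintype.card β < (A \ R).card := by
      rw [Nat.add_mul] at hA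
      omega
    obtain ⟨v, hvA, hvi, hv⟩ := ih _ h1
    obtain ⟨r, hrR, hr⟩ := hR (v (p (k + 1))) (Finset.mem_sdiff.1 (hvA _ (hp k))).1
    have hne : ∀ i ≤ k, v i ≠ r := by
      rintro i hi rfl
      exact (Finset.mem_sdiff.1 (hvA _ hi)).2 hrR
    refine ⟨fun i => if i ≤ k then v i else r, ?_, ?_, ?_⟩
    · intro i hi
      by_cases h : i ≤ k
      · simpa [h] using (Finset.mem_sdiff.1 (hvA _ h)).1
      · simpa [h] using hRA hrR
    · intro i hi j hj hij
      by_cases h : i ≤ k <;> by_cases h' : j ≤ k <;> simp only [h, h', if_true, if_false] at hij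
      · exact hvi i h j h' hij
      · exact absurd hij (hne i h)
      · exact absurd hij.symm (hne j h')
      · omega
    · intro j hj
      have hpj := hp j
      have h2 : p (j + 1) ≤ k := by omega
      by_cases h : j < k
      · have h3 : j + 1 ≤ k := h
        simp only [h2, h3, if_true]
        exact hv j h
      · obtain rfl : j = k := by omega
        simp only [h2, if_true]
        simpa using hr

theorem exists_equiv_two {V : Type*} [Fintype V] [DecidableEq V] (N : ℕ)
    (hN : Fintype.card V = N + 1) (h1 : 1 < N + 1) (a b : V) (hab : a ≠ b) :
    ∃ e : Fin (N + 1) ≃ V, e ⟨0, Nat.succ_pos N⟩ = a ∧ e ⟨1, h1⟩ = b := by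
  let e0 : Fin (N + 1) ≃ V := (Fintype.equivFinOfCardEq hN).symm
  let e1 := e0.trans (Equiv.swap (e0 ⟨0, Nat.succ_pos N⟩) a)
  have h0 : e1 ⟨0, Nat.succ_pos N⟩ = a := by simp [e1]
  refine ⟨e1.trans (Equiv.swap (e1 ⟨1, h1⟩) b), ?_, by simp⟩
  rw [Equiv.trans_apply, h0]
  apply Equiv.swap_apply_of_ne_of_ne _ hab
  rw [← h0]
  intro h
  have := e1.injective h
  simp at this

theorem shf_upper {t : ℕ} (ht : 2 ≤ t) (w : Fin t → ℕ) (hw : ∀ i, 1 ≤ w i) (N : ℕ)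
    (hu : N + 1 = ∑ i, w i) (hN : 1 ≤ N) (n q : ℕ) (F : Fin N → Fin n → Fin q)
    (hF : IsSHF N n q w F) : n ≤ N * q := by
  by_contra hlt
  push Not at hlt
  have hcard : Fintype.card (Σ i, Fin (w i)) = N + 1 := by simp [hu]
  obtain ⟨e, he0, he1⟩ := exists_equiv_two N hcard (by omega)
    (⟨⟨0, by omega⟩, ⟨0, hw _⟩⟩ : Σ i, Fin (w i)) ⟨⟨1, by omega⟩, ⟨0, hw _⟩⟩ (by simp)
  let f : ℕ → Fin n → Fin q := fun j => if h : j < N then F ⟨j, h⟩ else F ⟨0, hN⟩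
  let c : ℕ → Fin t := fun j => if h : j < N + 1 then (e ⟨j, h⟩).1 else ⟨0, by omega⟩
  have hc0 : c 0 = ⟨0, by omega⟩ := by simp only [c]; rw [dif_pos (Nat.succ_pos N), he0]
  have hc1 : c 1 = ⟨1, by omega⟩ := by simp only [c]; rw [dif_pos (by omega), he1]
  have hc01 : c 0 ≠ c 1 := by rw [hc0, hc1]; simp
  let p : ℕ → ℕ := fun j => if j ≤ 1 then 0 else if c j = c 0 then 1 else 0
  have hp : ∀ j, p (j + 1) ≤ j := by
    intro j
    simp only [p]
    split_ifs <;> omega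
  have hcp : ∀ j, c (j + 1) ≠ c (p (j + 1)) := by
    intro j
    by_cases h : j + 1 ≤ 1
    · obtain rfl : j = 0 := by omega
      simpa [p] using hc01.symm
    · by_cases h' : c (j + 1) = c 0
      · simp only [p, h, h', if_true, if_false]
        exact hc01
      · simp only [p, h, h', if_false]
        exact h'
  obtain ⟨v, -, hvi, hv⟩ := exists_tree f p hp N (Finset.univ : Finset (Fin n)) (by simpa using hlt)
  let C : Fin t → Finset (Fin n) := fun i =>
    Finset.univ.image (fun k : Fin (w i) => v (e.symm ⟨i, k⟩))
  have hinj : ∀ x y : Σ i, Fin (w i), v (e.symm x) = v (e.symm y) → x = y := by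
    intro x y h
    have := hvi _ (by have := (e.symm x).2; omega) _ (by have := (e.symm y).2; omega) h
    exact e.symm.injective (Fin.ext this)
  have hmem : ∀ j ≤ N, v j ∈ C (c j) := by
    intro j hj
    have hj' : j < N + 1 := by omega
    have : c j = (e ⟨j, hj'⟩).1 := by simp only [c]; rw [dif_pos hj']
    rw [this]
    refine Finset.mem_image.2 ⟨(e ⟨j, hj'⟩).2, Finset.mem_univ _, ?_⟩
    simp
  have hex := hF C ?_ ?_
  · obtain ⟨j, hj⟩ := hex
    have h1 := hj _ _ (hcp j) _ (hmem _ (by omega)) _ (hmem _ (by have := hp j; omega))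
    apply h1
    have h2 := hv j j.2
    simpa [f, j.2] using h2
  · intro i i' hii
    rw [Finset.disjoint_left]
    intro x hx hx'
    obtain ⟨k, -, rfl⟩ := Finset.mem_image.1 hx
    obtain ⟨k', -, h⟩ := Finset.mem_image.1 hx'
    have := congrArg Sigma.fst (hinj _ _ h)
    exact hii this.symm
  · intro i
    simp only [C]
    rw [Finset.card_image_of_injective]
    · simp
    · intro k k' h
      have := hinj _ _ h
      simpa using this

/-- The linear algebra step: `N + 1` points, `N` independent edges: connected. -/
theorem const_of_edges {V : Type*} [Fintype V] (N : ℕ) (hV : Fintype.card V = N + 1)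
    (x y : Fin N → V) (g : Fin N → V → ℚ) (hg : ∀ i k, g i (x k) - g i (y k) = if i = k then 1 else 0)
    (h : V → ℚ) (hh : ∀ k, h (x k) = h (y k)) (v0 v : V) : h v = h v0 := by
  let E : (V → ℚ) →ₗ[ℚ] (Fin N → ℚ) × ℚ :=
    { toFun := fun h => (fun k => h (x k) - h (y k), h v0)
      map_add' := by
        intro a b
        ext <;> simp
        ring
      map_smul' := by
        intro a b
        ext <;> simp
        ring }
  have hsurj : Function.Surjective E := by
    rintro ⟨a, b⟩
    refine ⟨fun v => ∑ i, a i * (g i v - g i v0) + b, ?_⟩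
    ext k
    · simp only [E, LinearMap.coe_mk, AddHom.coe_mk]
      rw [add_sub_add_right_eq_sub, ← Finset.sum_sub_distrib]
      have : ∀ i, a i * (g i (x k) - g i v0) - a i * (g i (y k) - g i v0)
          = if i = k then a i else 0 := by
        intro i
        have := hg i k
        rw [← mul_sub, sub_sub_sub_cancel_right, this]
        simp
      simp [this]
    · simp [E]
  have hinj : Function.Injective E := by
    refine (LinearMap.injective_iff_surjective_of_finrank_eq_finrank ?_).2 hsurj
    simp [hV]
  have : h = fun _ => h v0 := by
    apply hinj
    ext k
    · simp [E, hh]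
    · simp [E]
  exact congrFun this v

theorem shf_construct {t : ℕ} (w : Fin t → ℕ) (M : ℕ)
    (hu : M + 1 + 1 = ∑ i, w i) (d q : ℕ) (hq : d ^ (M + 1) + (M + 1) * d ^ M ≤ q) :
    ∃ F : Fin (M + 1) → Fin ((M + 1) * d ^ (M + 1)) → Fin q,
      IsSHF (M + 1) ((M + 1) * d ^ (M + 1)) q w F := by
  classical
  let X := Fin (M + 1) × (Fin (M + 1) → Fin d)
  let Y := (Fin (M + 1) → Fin d) ⊕ (Fin (M + 1) × (Fin M → Fin d))
  have hX : Fintype.card X = (M + 1) * d ^ (M + 1) := by simp [X]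
  have hY : Fintype.card Y ≤ Fintype.card (Fin q) := by simpa [Y] using hq
  let e : Fin ((M + 1) * d ^ (M + 1)) ≃ X := (Fintype.equivFinOfCardEq hX).symm
  obtain ⟨emb⟩ : Nonempty (Y ↪ Fin q) := Function.Embedding.nonempty_of_card_le hY
  let f : Fin (M + 1) → X → Y := fun i z =>
    if z.1 = i then Sum.inl z.2 else Sum.inr (z.1, i.removeNth z.2)
  have hf : ∀ i z z', f i z = f i z' → z ≠ z' →
      z.1 = z'.1 ∧ z.1 ≠ i ∧ z.2 i ≠ z'.2 i ∧ ∀ k, k ≠ i → z.2 k = z'.2 k := by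
    rintro i ⟨j, a⟩ ⟨j', a'⟩ h hne
    by_cases h1 : j = i <;> by_cases h2 : j' = i <;> simp [f, h1, h2] at h
    · exact absurd (by rw [h1, h2, Sum.inl.inj h]) hne
    · obtain ⟨hj, ha⟩ := Prod.mk.inj (Sum.inr.inj h)
      have hk : ∀ k, k ≠ i → a k = a' k := by
        intro k hk
        obtain ⟨l, rfl⟩ := Fin.exists_succAbove_eq hk
        exact congrFun ha l
      refine ⟨hj, h1, ?_, hk⟩
      intro hai
      apply hne
      have : a = a' := by
        funext k
        by_cases hki : k = i
        · rw [hki]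
          exact hai
        · exact hk k hki
      rw [hj, this]
  refine ⟨fun i z => emb (f i (e z)), ?_⟩
  intro C hdisj hcard
  by_contra hcon
  push Not at hcon
  have hex : ∀ i : Fin (M + 1), ∃ z z', (∃ k, z ∈ C k) ∧ (∃ k, z' ∈ C k) ∧ z ≠ z' ∧
      f i (e z) = f i (e z') := by
    intro i
    have := hcon i
    unfold Separates at this
    push Not at this
    obtain ⟨k, k', hkk, z, hz, z', hz', h⟩ := this
    refine ⟨z, z', ⟨k, hz⟩, ⟨k', hz'⟩, ?_, emb.injective h⟩
    rintro rfl
    exact Finset.disjoint_left.1 (hdisj k k' hkk) hz hz'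
  choose x y hx hy hxy hfxy using hex
  let V := Finset.univ.biUnion C
  have hVc : Fintype.card V = M + 1 + 1 := by
    rw [Fintype.card_coe, Finset.card_biUnion (fun i _ j _ h => hdisj i j h), hu]
    exact Finset.sum_congr rfl (fun i _ => hcard i)
  let x' : Fin (M + 1) → V := fun i => ⟨x i, by simpa [V] using hx i⟩
  let y' : Fin (M + 1) → V := fun i => ⟨y i, by simpa [V] using hy i⟩
  have key := fun i => hf i _ _ (hfxy i) (fun h => hxy i (e.injective h))
  let j := (e (x 0)).1
  have hconst := const_of_edges (M + 1) hVc x' y'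
    (fun i z => if (e z).2 i = (e (x i)).2 i then 1 else 0) ?_
    (fun z => if (e z).1 = j then 1 else 0) ?_ (x' 0) (x' j)
  · have h0 : (e (x j)).1 = j := by
      by_contra h
      simp [x', h, j] at hconst
    exact (key j).2.1 h0
  · intro i k
    by_cases hik : i = k
    · subst hik
      have := (key i).2.2.1
      simp [x', y', this.symm]
    · have := (key k).2.2.2 i hik
      simp [x', y', this, hik]
  · intro k
    have := (key k).1
    simp [x', y', this]

theorem stmt_2 {t : ℕ} (ht : 2 ≤ t) (w : Fin t → ℕ) (hw : ∀ i, 1 ≤ w i)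
    (u : ℕ) (hu : u = ∑ i, w i) :
    Filter.Tendsto (fun q : ℕ => (maxSHF (u - 1) q w : ℝ) / (q : ℝ))
      Filter.atTop (nhds ((u : ℝ) - 1)) ∧
    IsLeast {γ : ℝ | ∀ q : ℕ, (maxSHF (u - 1) q w : ℝ) ≤ γ * (q : ℝ)} ((u : ℝ) - 1) := by
  have hu2 : 2 ≤ u := by
    calc 2 ≤ t := ht
      _ = ∑ _i : Fin t, 1 := by simp
      _ ≤ u := by rw [hu]; exact Finset.sum_le_sum (fun i _ => hw i)
  obtain ⟨M, rfl⟩ : ∃ M, u = M + 1 + 1 := ⟨u - 2, by omega⟩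
  have hN : M + 1 + 1 - 1 = M + 1 := rfl
  rw [hN]
  have hcast : (((M + 1 + 1 : ℕ) : ℝ) - 1) = (M : ℝ) + 1 := by push_cast; ring
  rw [hcast]
  have hupS : ∀ q n, n ∈ {n | ∃ F : Fin (M + 1) → Fin n → Fin q, IsSHF (M + 1) n q w F} →
      n ≤ (M + 1) * q := by
    rintro q n ⟨F, hF⟩
    exact shf_upper ht w hw (M + 1) hu (by omega) n q F hF
  have hup : ∀ q, maxSHF (M + 1) q w ≤ (M + 1) * q := by
    intro q
    unfold maxSHF
    exact csSup_le' (fun n hn => hupS q n hn)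
  have hupR : ∀ q : ℕ, (maxSHF (M + 1) q w : ℝ) ≤ ((M : ℝ) + 1) * q := by
    intro q
    exact_mod_cast hup q
  have hlow : ∀ q d : ℕ, d ^ (M + 1) + (M + 1) * d ^ M ≤ q →
      (M + 1) * d ^ (M + 1) ≤ maxSHF (M + 1) q w := by
    intro q d h
    unfold maxSHF
    exact le_csSup ⟨_, fun n hn => hupS q n hn⟩ (shf_construct w M hu d q h)
  have hlim : Filter.Tendsto (fun q : ℕ => (maxSHF (M + 1) q w : ℝ) / (q : ℝ))
      Filter.atTop (nhds ((M : ℝ) + 1)) := by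
    let s : ℕ → ℝ := fun q => (q : ℝ) ^ (1 / ((M : ℝ) + 1))
    have hs : Filter.Tendsto s Filter.atTop Filter.atTop :=
      (tendsto_rpow_atTop (by positivity)).comp tendsto_natCast_atTop_atTop
    have hsq : ∀ q : ℕ, s q ^ (M + 1) = q := by
      intro q
      have := Real.rpow_inv_natCast_pow (Nat.cast_nonneg (α := ℝ) q) (Nat.succ_ne_zero M)
      simpa [s] using this
    have hL : Filter.Tendsto (fun q : ℕ => ((M : ℝ) + 1) * (1 - ((M : ℝ) + 2) / s q) ^ (M + 1))
        Filter.atTop (nhds ((M : ℝ) + 1)) := by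
      have h1 := ((hs.const_div_atTop ((M : ℝ) + 2)).const_sub 1).pow (M + 1)
      simpa using h1.const_mul ((M : ℝ) + 1)
    refine tendsto_of_tendsto_of_tendsto_of_le_of_le' hL tendsto_const_nhds ?_ ?_
    · filter_upwards [hs.eventually_ge_atTop ((M : ℝ) + 2)] with q hq
      have hM0 : (0 : ℝ) ≤ M := Nat.cast_nonneg M
      have hs0 : 0 < s q := by linarith
      have hq0 : (0 : ℝ) < q := by rw [← hsq q]; positivity
      have hr1 : (⌊s q⌋₊ : ℝ) ≤ s q := Nat.floor_le hs0.le
      have hr2 : s q < ⌊s q⌋₊ + 1 := Nat.lt_floor_add_one _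
      have hr3 : M + 1 ≤ ⌊s q⌋₊ := by
        apply Nat.le_floor
        push_cast
        linarith
      obtain ⟨d, hd⟩ : ∃ d, ⌊s q⌋₊ = d + (M + 1) := ⟨_, (Nat.sub_add_cancel hr3).symm⟩
      rw [hd] at hr1 hr2
      push_cast at hr1 hr2
      have hdq : d ^ (M + 1) + (M + 1) * d ^ M ≤ q := by
        have h1 : d ^ (M + 1) + (M + 1) * d ^ M ≤ (d + (M + 1)) ^ (M + 1) := by
          calc d ^ (M + 1) + (M + 1) * d ^ M = d ^ M * (d + (M + 1)) := by ring
            _ ≤ (d + (M + 1)) ^ M * (d + (M + 1)) := by gcongr; omega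
            _ = _ := by ring
        refine h1.trans ?_
        have h2 : ((d : ℝ) + (M + 1)) ^ (M + 1) ≤ s q ^ (M + 1) := by gcongr
        rw [hsq] at h2
        exact_mod_cast h2
      have h3 : ((M : ℝ) + 1) * (d : ℝ) ^ (M + 1) ≤ maxSHF (M + 1) q w := by
        exact_mod_cast hlow q d hdq
      rw [le_div_iff₀ hq0, mul_assoc]
      refine le_trans ?_ h3
      gcongr
      rw [← hsq q, ← mul_pow]
      have h4 : (1 - ((M : ℝ) + 2) / s q) * s q = s q - (M + 2) := by
        field_simp
      rw [h4]
      apply pow_le_pow_left₀ <;> linarith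
    · filter_upwards [Filter.eventually_gt_atTop 0] with q hq
      rw [div_le_iff₀ (by exact_mod_cast hq)]
      exact hupR q
  refine ⟨hlim, hupR, ?_⟩
  intro γ hγ
  refine le_of_tendsto hlim ?_
  filter_upwards [Filter.eventually_gt_atTop 0] with q hq
  rw [div_le_iff₀ (by exact_mod_cast hq)]
  exact hγ q
end

section
/- (Johnson-type bound) Let N, q, t, w_1, ..., w_t be positive integers with q ≥ t ≥ 2, u = w_1 + ... + w_t, and let l be an integer with 1 ≤ l ≤ N. Then for every index i with 1 ≤ i ≤ t and w_i ≥ 2, C(N, q, {w_1,...,w_t}) ≤ q^l + max{ u-1, C(N-l, q, {w_1,...,w_{i-1}, w_i - 1, w_{i+1},...,w_t}) }. -/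
lemma shf_bddAbove {t : ℕ} (ht : 2 ≤ t) (M q : ℕ) (w : Fin t → ℕ) (hw : ∀ i, 1 ≤ w i) :
    BddAbove {n | ∃ F : Fin M → Fin n → Fin q, IsSHF M n q w F} := by
  refine ⟨q ^ M + ∑ i, w i, ?_⟩
  rintro n ⟨F, hF⟩
  by_contra! hn
  obtain ⟨x, y, hxy, hg⟩ := Fintype.exists_ne_map_eq_of_card_lt
    (fun (x : Fin n) (k : Fin M) => F k x) (by simp; omega)
  obtain ⟨e⟩ : Nonempty ((Σ i : Fin t, Fin (w i)) ↪ Fin n) :=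
    Function.Embedding.nonempty_of_card_le (by simp; omega)
  let a : Fin t := ⟨0, by omega⟩
  let b : Fin t := ⟨1, by omega⟩
  have hab : a ≠ b := by simp [a, b]
  let p : Σ i : Fin t, Fin (w i) := ⟨a, ⟨0, hw a⟩⟩
  let p' : Σ i : Fin t, Fin (w i) := ⟨b, ⟨0, hw b⟩⟩
  have hp : p ≠ p' := fun h => hab (congrArg Sigma.fst h)
  have hep : e p ≠ e p' := fun h => hp (e.injective h)
  obtain ⟨σ, h1, h2⟩ : ∃ σ : Equiv.Perm (Fin n), σ (e p) = x ∧ σ (e p') = y := by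
    let τ := Equiv.swap (e p) x
    have h0 : τ (e p) = x := Equiv.swap_apply_left _ _
    refine ⟨τ.trans (Equiv.swap (τ (e p')) y), ?_, ?_⟩
    · rw [Equiv.trans_apply, h0]
      apply Equiv.swap_apply_of_ne_of_ne _ hxy
      intro h
      exact hep (τ.injective (h0.trans h))
    · simp
  have key := hF (fun i => Finset.univ.image (fun z : Fin (w i) => σ (e ⟨i, z⟩)))
  suffices hh : _ ∧ _ by
    obtain ⟨k, hk⟩ := key hh.1 hh.2
    refine hk a b hab x ?_ y ?_ (congrFun hg k)
    · exact Finset.mem_image.2 ⟨⟨0, hw a⟩, Finset.mem_univ _, h1⟩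
    · exact Finset.mem_image.2 ⟨⟨0, hw b⟩, Finset.mem_univ _, h2⟩
  refine ⟨?_, ?_⟩
  · intro i j hij
    rw [Finset.disjoint_left]
    intro z hz hz'
    obtain ⟨c, -, hc⟩ := Finset.mem_image.1 hz
    obtain ⟨d, -, hd⟩ := Finset.mem_image.1 hz'
    have := e.injective (σ.injective (hc.trans hd.symm))
    exact hij (congrArg Sigma.fst this)
  · intro i
    rw [Finset.card_image_of_injective]
    · simp
    · intro c d hcd
      have := e.injective (σ.injective hcd)
      simpa using this

lemma shf_shorten {t : ℕ} (ht : 2 ≤ t) (N q n : ℕ) (w : Fin t → ℕ) (hw : ∀ i, 1 ≤ w i)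
    (l : ℕ) (hl2 : l ≤ N) (i : Fin t) (hwi : 2 ≤ w i)
    (F : Fin N → Fin n → Fin q) (hF : IsSHF N n q w F) (hn : 0 < n) :
    ∃ m, n ≤ q ^ l + m ∧ ∃ G : Fin (N - l) → Fin m → Fin q,
      IsSHF (N - l) m q (Function.update w i (w i - 1)) G := by
  classical
  have : Nonempty (Fin n) := ⟨⟨0, hn⟩⟩
  let g : Fin n → (Fin l → Fin q) := fun x k => F ⟨k, by omega⟩ x
  let s := Function.invFun g
  have hs : ∀ x, g (s (g x)) = g x := fun x => Function.invFun_eq ⟨x, rfl⟩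
  let A : Finset (Fin n) := Finset.univ.image s
  have hA : A.card ≤ q ^ l := by
    refine Finset.card_image_le.trans ?_
    simp
  let e : Fin (Aᶜ.card) ↪ Fin n := (Aᶜ.orderEmbOfFin rfl).toEmbedding
  have he : ∀ z, e z ∉ A := fun z => by
    have := Aᶜ.orderEmbOfFin_mem rfl z
    exact Finset.mem_compl.1 this
  refine ⟨Aᶜ.card, ?_, fun k z => F ⟨k + l, by omega⟩ (e z), ?_⟩
  · rw [Finset.card_compl, Fintype.card_fin]; omega
  intro C hC hcard
  obtain ⟨j, hj⟩ : ∃ j : Fin t, j ≠ i := by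
    have : Nontrivial (Fin t) := Fin.nontrivial_iff_two_le.2 ht
    exact exists_ne i
  have hjc : (C j).Nonempty := by
    rw [← Finset.card_pos, hcard j, Function.update_of_ne hj]
    exact hw j
  obtain ⟨x, hx⟩ := hjc
  let a := s (g (e x))
  have ha : a ∈ A := Finset.mem_image_of_mem _ (Finset.mem_univ _)
  have haC : ∀ k, a ∉ (C k).map e := by
    intro k h
    obtain ⟨z, -, hz⟩ := Finset.mem_map.1 h
    exact he z (hz ▸ ha)
  let D : Fin t → Finset (Fin n) :=
    Function.update (fun k => (C k).map e) i (insert a ((C i).map e))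
  have hDi : D i = insert a ((C i).map e) := Function.update_self _ _ _
  have hDk : ∀ k, k ≠ i → D k = (C k).map e := fun k hk => Function.update_of_ne hk _ _
  have hsub : ∀ k, (C k).map e ⊆ D k := by
    intro k
    by_cases hk : k = i
    · subst hk; rw [hDi]; exact Finset.subset_insert _ _
    · rw [hDk k hk]
  have hdm : ∀ k k', k ≠ k' → Disjoint ((C k).map e) ((C k').map e) := fun k k' h =>
    (Finset.disjoint_map e).2 (hC k k' h)
  suffices hh : _ ∧ _ by
    obtain ⟨f, hf⟩ := hF D hh.1 hh.2
    have hfl : l ≤ f.1 := by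
      by_contra! hlt
      refine hf i j hj.symm a (by rw [hDi]; exact Finset.mem_insert_self _ _) (e x)
        (hsub j (Finset.mem_map_of_mem e hx)) ?_
      exact congrFun (hs (e x)) ⟨f.1, hlt⟩
    refine ⟨⟨f.1 - l, by omega⟩, ?_⟩
    intro k k' hkk y hy y' hy'
    have h := hf k k' hkk (e y) (hsub k (Finset.mem_map_of_mem e hy)) (e y')
      (hsub k' (Finset.mem_map_of_mem e hy'))
    have hfe : (⟨f.1 - l + l, by omega⟩ : Fin N) = f := Fin.ext (by simp; omega)
    simpa [hfe] using h
  refine ⟨?_, ?_⟩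
  · intro k k' hkk
    by_cases hk : k = i
    · subst hk
      rw [hDi, hDk k' hkk.symm, Finset.disjoint_insert_left]
      exact ⟨haC k', hdm _ _ hkk⟩
    · by_cases hk' : k' = i
      · subst hk'
        rw [hDi, hDk k hk, Finset.disjoint_insert_right]
        exact ⟨haC k, hdm _ _ hkk⟩
      · rw [hDk k hk, hDk k' hk']
        exact hdm _ _ hkk
  · intro k
    by_cases hk : k = i
    · subst hk
      rw [hDi, Finset.card_insert_of_notMem (haC k), Finset.card_map, hcard k,
        Function.update_self]
      omega
    · rw [hDk k hk, Finset.card_map, hcard k, Function.update_of_ne hk]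

theorem stmt_3 {t : ℕ} (ht : 2 ≤ t) (N q : ℕ) (hN : 1 ≤ N) (hq : t ≤ q)
    (w : Fin t → ℕ) (hw : ∀ i, 1 ≤ w i) (u : ℕ) (hu : u = ∑ i, w i)
    (l : ℕ) (hl1 : 1 ≤ l) (hl2 : l ≤ N)
    (i : Fin t) (hwi : 2 ≤ w i) :
    maxSHF N q w ≤
      q ^ l + max (u - 1) (maxSHF (N - l) q (Function.update w i (w i - 1))) := by
  refine csSup_le' ?_
  rintro n ⟨F, hF⟩
  rcases Nat.eq_zero_or_pos n with rfl | hn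
  · exact Nat.zero_le _
  obtain ⟨m, hm, hG⟩ := shf_shorten ht N q n w hw l hl2 i hwi F hF hn
  have hb := shf_bddAbove ht (N - l) q (Function.update w i (w i - 1)) (by
    intro k
    by_cases hk : k = i
    · subst hk; rw [Function.update_self]; omega
    · rw [Function.update_of_ne hk]; exact hw k)
  have h1 : m ≤ maxSHF (N - l) q (Function.update w i (w i - 1)) := le_csSup hb hG
  exact hm.trans (Nat.add_le_add_left (h1.trans (le_max_right _ _)) _)
end

section
/- There is a constant γ > 0 such that for every sufficiently large integer q, setting μ = ⌈2^{√(log q)}⌉, there exists a set M ⊆ {0, 1, ..., ⌊(q-1)/(μ+5)⌋} with |M| ≥ q·e^{-γ(log q)^{3/4}} such that M has no non-trivial solution (i.e., no solution except ones with all variables equal) to any of the following seven equations: 2m_1+3m_2+μm_3-(μ+5)m_4=0; 5m_1+(μ+3)m_2-3m_3-(μ+5)m_4=0; 5m_1+μm_2-2m_3-(μ+3)m_4=0; 2m_1+3m_2-5m_3=0; 5m_1+μm_2-(μ+5)m_3=0; 2m_1+(μ+3)m_2-(μ+5)m_3=0; 3m_1+μm_2-(μ+3)m_3=0. -/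
/-- `A` has only trivial solutions to convex equations of total weight at most 6. -/
def Cvx6 (A : Finset ℕ) : Prop :=
  ∀ p1 p2 p3 : ℕ, 0 < p1 → 0 < p2 → 0 < p3 → p1 + p2 + p3 ≤ 6 →
    ∀ x1 ∈ A, ∀ x2 ∈ A, ∀ x3 ∈ A, ∀ y ∈ A,
      p1 * x1 + p2 * x2 + p3 * x3 = (p1 + p2 + p3) * y → x1 = y ∧ x2 = y ∧ x3 = y

/-- Numbers with `d` digits in base `B`, all from `A`. -/
def DigSet (B : ℕ) (A : Finset ℕ) : ℕ → Finset ℕ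
  | 0 => {0}
  | d + 1 => (A ×ˢ DigSet B A d).image (fun z => z.1 + B * z.2)

theorem digSet_card (B : ℕ) (A : Finset ℕ) (hA : ∀ a ∈ A, 6 * a < B) (d : ℕ) :
    (DigSet B A d).card = A.card ^ d := by
  induction d with
  | zero => simp [DigSet]
  | succ d ih =>
    rw [DigSet, Finset.card_image_of_injOn, Finset.card_product, ih, pow_succ, mul_comm]
    rintro ⟨a, m⟩ h ⟨a', m'⟩ h' he
    simp only [Finset.coe_product, Set.mem_prod, Finset.mem_coe] at h h' he
    have h1 := hA a h.1
    have h2 := hA a' h'.1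
    have e1 : (a + B * m) % B = a := by
      rw [Nat.add_mul_mod_self_left, Nat.mod_eq_of_lt (by omega)]
    have e2 : (a' + B * m') % B = a' := by
      rw [Nat.add_mul_mod_self_left, Nat.mod_eq_of_lt (by omega)]
    have e3 : a = a' := by rw [← e1, ← e2, he]
    subst e3
    have e4 : B * m = B * m' := by omega
    have e5 := Nat.eq_of_mul_eq_mul_left (by omega) e4
    rw [e5]

theorem digSet_lt (B : ℕ) (A : Finset ℕ) (hA : ∀ a ∈ A, 6 * a < B) (d : ℕ) :
    ∀ x ∈ DigSet B A d, x < B ^ d := by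
  induction d with
  | zero => simp [DigSet]
  | succ d ih =>
    intro x hx
    simp only [DigSet, Finset.mem_image, Finset.mem_product, Prod.exists] at hx
    obtain ⟨a, m, ⟨ha, hm⟩, rfl⟩ := hx
    have h1 := hA a ha
    have h2 := ih m hm
    have h3 : B * (m + 1) ≤ B * B ^ d := Nat.mul_le_mul_left _ h2
    rw [pow_succ, mul_comm (B ^ d)]
    rw [mul_add] at h3
    omega

theorem digSet_free (B : ℕ) (A : Finset ℕ) (hA : ∀ a ∈ A, 6 * a < B) (hC : Cvx6 A)
    (p1 p2 p3 : ℕ) (h1 : 0 < p1) (h2 : 0 < p2) (h3 : 0 < p3) (hp : p1 + p2 + p3 ≤ 6)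
    (c1 c2 c3 : ℤ) (d : ℕ) :
    ∀ x1 ∈ DigSet B A d, ∀ x2 ∈ DigSet B A d, ∀ x3 ∈ DigSet B A d, ∀ y ∈ DigSet B A d,
      (p1 * ((x1 : ℤ) - y) + p2 * ((x2 : ℤ) - y) + p3 * ((x3 : ℤ) - y) =
        B * (c1 * ((x1 : ℤ) - y) + c2 * ((x2 : ℤ) - y) + c3 * ((x3 : ℤ) - y))) →
      x1 = y ∧ x2 = y ∧ x3 = y := by
  induction d with
  | zero => simp [DigSet]
  | succ d ih =>
    intro x1 hx1 x2 hx2 x3 hx3 y hy he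
    simp only [DigSet, Finset.mem_image, Finset.mem_product, Prod.exists] at hx1 hx2 hx3 hy
    obtain ⟨a1, m1, ⟨ha1, hm1⟩, rfl⟩ := hx1
    obtain ⟨a2, m2, ⟨ha2, hm2⟩, rfl⟩ := hx2
    obtain ⟨a3, m3, ⟨ha3, hm3⟩, rfl⟩ := hx3
    obtain ⟨b, n, ⟨hb, hn⟩, rfl⟩ := hy
    have l1 := hA a1 ha1
    have l2 := hA a2 ha2
    have l3 := hA a3 ha3
    have l4 := hA b hb
    push_cast at he
    have hBpos : (0 : ℤ) < B := by exact_mod_cast (by omega : 0 < B)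
    have hdvd : (B : ℤ) ∣ (p1 * a1 + p2 * a2 + p3 * a3 : ℤ) - (p1 + p2 + p3) * b := by
      refine ⟨c1 * ((a1 + B * m1 : ℤ) - (b + B * n)) + c2 * ((a2 + B * m2 : ℤ) - (b + B * n))
        + c3 * ((a3 + B * m3 : ℤ) - (b + B * n)) - (p1 * ((m1 : ℤ) - n) + p2 * ((m2 : ℤ) - n)
        + p3 * ((m3 : ℤ) - n)), ?_⟩
      linear_combination he
    have key : ∀ a1 a2 a3 : ℕ, 6 * a1 < B → 6 * a2 < B → 6 * a3 < B →
        p1 * a1 + p2 * a2 + p3 * a3 < B := by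
      intro a1 a2 a3 l1 l2 l3
      have t1 : 6 * (p1 * a1) ≤ p1 * (B - 1) := by
        calc 6 * (p1 * a1) = p1 * (6 * a1) := by ring
          _ ≤ _ := Nat.mul_le_mul_left _ (by omega)
      have t2 : 6 * (p2 * a2) ≤ p2 * (B - 1) := by
        calc 6 * (p2 * a2) = p2 * (6 * a2) := by ring
          _ ≤ _ := Nat.mul_le_mul_left _ (by omega)
      have t3 : 6 * (p3 * a3) ≤ p3 * (B - 1) := by
        calc 6 * (p3 * a3) = p3 * (6 * a3) := by ring
          _ ≤ _ := Nat.mul_le_mul_left _ (by omega)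
      have t4 : (p1 + p2 + p3) * (B - 1) ≤ 6 * (B - 1) := Nat.mul_le_mul_right _ hp
      rw [add_mul, add_mul] at t4
      omega
    have k1 := key a1 a2 a3 l1 l2 l3
    have k2 := key b b b l4 l4 l4
    have hz : (p1 * a1 + p2 * a2 + p3 * a3 : ℤ) - (p1 + p2 + p3) * b = 0 := by
      apply Int.eq_zero_of_abs_lt_dvd hdvd
      zify at k1 k2
      have g1 : (0 : ℤ) ≤ p1 * a1 + p2 * a2 + p3 * a3 := by positivity
      have g2 : (0 : ℤ) ≤ p1 * b + p2 * b + p3 * b := by positivity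
      rw [abs_lt]
      constructor <;> linarith
    have hN : p1 * a1 + p2 * a2 + p3 * a3 = (p1 + p2 + p3) * b := by
      zify
      linarith
    obtain ⟨rfl, rfl, rfl⟩ := hC p1 p2 p3 h1 h2 h3 hp a1 ha1 a2 ha2 a3 ha3 _ hb hN
    have := ih m1 hm1 m2 hm2 m3 hm3 n hn (by
      apply mul_left_cancel₀ hBpos.ne'
      linear_combination he)
    obtain ⟨rfl, rfl, rfl⟩ := this
    simp

theorem behrend_cvx (n s k : ℕ) :
    Cvx6 ((Behrend.sphere n s k).image (Behrend.map (8 * s))) := by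
  intro p1 p2 p3 h1 h2 h3 hp x1 hx1 x2 hx2 x3 hx3 y hy he
  simp only [Finset.mem_image] at hx1 hx2 hx3 hy
  obtain ⟨v1, hv1, rfl⟩ := hx1
  obtain ⟨v2, hv2, rfl⟩ := hx2
  obtain ⟨v3, hv3, rfl⟩ := hx3
  obtain ⟨w, hw, rfl⟩ := hy
  simp only [Behrend.sphere, Finset.mem_filter, Behrend.mem_box] at hv1 hv2 hv3 hw
  have key : ∀ a1 a2 a3 : ℕ, a1 < s → a2 < s → a3 < s →
        p1 * a1 + p2 * a2 + p3 * a3 < 8 * s := by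
    intro a1 a2 a3 l1 l2 l3
    have t1 : p1 * a1 ≤ p1 * s := Nat.mul_le_mul_left _ l1.le
    have t2 : p2 * a2 ≤ p2 * s := Nat.mul_le_mul_left _ l2.le
    have t3 : p3 * a3 ≤ p3 * s := Nat.mul_le_mul_left _ l3.le
    have t4 : (p1 + p2 + p3) * s ≤ 6 * s := Nat.mul_le_mul_right _ hp
    rw [add_mul, add_mul] at t4
    omega
  have hm : Behrend.map (8 * s) (p1 • v1 + p2 • v2 + p3 • v3) =
      Behrend.map (8 * s) (p1 • w + p2 • w + p3 • w) := by
    simp only [map_add, map_nsmul, smul_eq_mul]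
    linarith
  have hv := Behrend.map_injOn (d := 8 * s) (x₁ := p1 • v1 + p2 • v2 + p3 • v3)
    (x₂ := p1 • w + p2 • w + p3 • w)
    (by intro i; simpa using key _ _ _ (hv1.1 i) (hv2.1 i) (hv3.1 i))
    (by intro i; simpa using key _ _ _ (hw.1 i) (hw.1 i) (hw.1 i)) hm
  have hc : ∀ i, (p1 : ℤ) * v1 i + p2 * v2 i + p3 * v3 i = (p1 + p2 + p3) * w i := by
    intro i
    have := congrFun hv i
    simp only [Pi.add_apply, Pi.smul_apply, smul_eq_mul] at this
    zify at this
    linarith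
  have q1 : ∑ i, (v1 i : ℤ) ^ 2 = k := by exact_mod_cast hv1.2
  have q2 : ∑ i, (v2 i : ℤ) ^ 2 = k := by exact_mod_cast hv2.2
  have q3 : ∑ i, (v3 i : ℤ) ^ 2 = k := by exact_mod_cast hv3.2
  have q4 : ∑ i, (w i : ℤ) ^ 2 = k := by exact_mod_cast hw.2
  have hsum : ∑ i, ((p1 : ℤ) * ((v1 i : ℤ) - w i) ^ 2 + p2 * ((v2 i : ℤ) - w i) ^ 2
      + p3 * ((v3 i : ℤ) - w i) ^ 2) = 0 := by
    have : ∀ i, ((p1 : ℤ) * ((v1 i : ℤ) - w i) ^ 2 + p2 * ((v2 i : ℤ) - w i) ^ 2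
      + p3 * ((v3 i : ℤ) - w i) ^ 2) = p1 * (v1 i : ℤ) ^ 2 + p2 * (v2 i : ℤ) ^ 2
      + p3 * (v3 i : ℤ) ^ 2 - (p1 + p2 + p3) * (w i : ℤ) ^ 2 := by
      intro i
      linear_combination (-2 * (w i : ℤ)) * hc i
    simp only [this, Finset.sum_sub_distrib, Finset.sum_add_distrib, ← Finset.mul_sum,
      q1, q2, q3, q4]
    ring
  have hz := (Finset.sum_eq_zero_iff_of_nonneg (fun i _ => by positivity)).1 hsum
  have r : ∀ i, v1 i = w i ∧ v2 i = w i ∧ v3 i = w i := by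
    intro i
    have hi := hz i (Finset.mem_univ i)
    have P1 : (0 : ℤ) < p1 := by exact_mod_cast h1
    have P2 : (0 : ℤ) < p2 := by exact_mod_cast h2
    have P3 : (0 : ℤ) < p3 := by exact_mod_cast h3
    have n1 : 0 ≤ (p1 : ℤ) * ((v1 i : ℤ) - w i) ^ 2 := by positivity
    have n2 : 0 ≤ (p2 : ℤ) * ((v2 i : ℤ) - w i) ^ 2 := by positivity
    have n3 : 0 ≤ (p3 : ℤ) * ((v3 i : ℤ) - w i) ^ 2 := by positivity
    have z1 : (p1 : ℤ) * ((v1 i : ℤ) - w i) ^ 2 = 0 := by linarith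
    have z2 : (p2 : ℤ) * ((v2 i : ℤ) - w i) ^ 2 = 0 := by linarith
    have z3 : (p3 : ℤ) * ((v3 i : ℤ) - w i) ^ 2 = 0 := by linarith
    simp only [mul_eq_zero, P1.ne', P2.ne', P3.ne', false_or, ne_eq, OfNat.ofNat_ne_zero,
      not_false_eq_true, pow_eq_zero_iff] at z1 z2 z3
    omega
  refine ⟨?_, ?_, ?_⟩
  · rw [funext fun i => (r i).1]
  · rw [funext fun i => (r i).2.1]
  · rw [funext fun i => (r i).2.2]

theorem exists_digits (n : ℕ) : ∃ A : Finset ℕ, Cvx6 A ∧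
    (∀ a ∈ A, a < 2 ^ (n ^ 2 + 3 * n)) ∧ 2 ^ (n ^ 2) ≤ A.card * 2 ^ (3 * n) := by
  obtain ⟨k, -, hk⟩ := Behrend.exists_large_sphere_aux n (2 ^ n)
  refine ⟨_, behrend_cvx n (2 ^ n) k, ?_, ?_⟩
  · intro a ha
    simp only [Finset.mem_image] at ha
    obtain ⟨v, hv, rfl⟩ := ha
    simp only [Behrend.sphere, Finset.mem_filter, Behrend.mem_box] at hv
    have h1 : ∀ i, v i ≤ 2 ^ n := fun i => (hv.1 i).le
    have e : 2 ^ (n ^ 2 + 3 * n) = (8 * 2 ^ n) ^ n := by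
      rw [show (8 : ℕ) = 2 ^ 3 by norm_num, ← pow_add, ← pow_mul]
      congr 1
      ring
    rw [e, Behrend.map_apply]
    have hlt := fun i => lt_of_lt_of_le (hv.1 i) (by omega : 2 ^ n ≤ 8 * 2 ^ n)
    clear hk h1 e hv
    generalize 8 * 2 ^ n = D at hlt
    induction n with
    | zero => simp
    | succ n ih =>
      rw [Fin.sum_univ_castSucc]
      have := ih (fun i => v i.castSucc) (fun i => hlt _)
      simp only [Fin.val_castSucc, Fin.val_last]
      have h2 : (v (Fin.last n) + 1) * D ^ n ≤ D * D ^ n := Nat.mul_le_mul_right _ (hlt _)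
      rw [pow_succ, mul_comm (D ^ n)]
      rw [add_mul, one_mul] at h2
      omega
  · rw [Finset.card_image_of_injOn]
    · rw [div_le_iff₀ (by positivity)] at hk
      have h3 : n * (2 ^ n - 1) ^ 2 + 1 ≤ 2 ^ (3 * n) := by
        have a1 : n + 1 ≤ 2 ^ n := Nat.lt_two_pow_self
        have a2 : n * (2 ^ n - 1) ^ 2 ≤ n * (2 ^ n) ^ 2 :=
          Nat.mul_le_mul_left _ (Nat.pow_le_pow_left (by omega) 2)
        have a3 : (n + 1) * (2 ^ n) ^ 2 ≤ 2 ^ n * (2 ^ n) ^ 2 := Nat.mul_le_mul_right _ a1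
        have a4 : 0 < (2 ^ n) ^ 2 := by positivity
        have a5 : 2 ^ (3 * n) = 2 ^ n * (2 ^ n) ^ 2 := by ring
        rw [a5]
        rw [add_mul] at a3
        omega
      have hk' : 2 ^ (n ^ 2) ≤ (Behrend.sphere n (2 ^ n) k).card * (n * (2 ^ n - 1) ^ 2 + 1) := by
        have : (2 ^ n) ^ n = 2 ^ (n ^ 2) := by rw [← pow_mul, sq]
        rw [← this]
        have hp : 1 ≤ 2 ^ n := Nat.one_le_two_pow
        have hk2 := hk
        norm_cast at hk2
      exact hk'.trans (Nat.mul_le_mul_left _ h3)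
    · apply Set.InjOn.mono _ Behrend.map_injOn
      intro v hv i
      simp only [Behrend.sphere, Finset.coe_filter, Behrend.mem_box, Set.mem_ofPred_eq] at hv
      have := hv.1 i
      show v i < 8 * 2 ^ n
      omega

/-- Intersecting suitable translates of three sets. -/
theorem exists_inter (M1 M2 M3 : Finset ℕ) (Q : ℕ) (hQ : 0 < Q) (h1 : ∀ x ∈ M1, x < Q)
    (h2 : ∀ x ∈ M2, x < Q) (h3 : ∀ x ∈ M3, x < Q) :
    ∃ M ⊆ M1, (∃ t : ℤ, ∀ m ∈ M, ∃ x ∈ M2, (m : ℤ) = x + t) ∧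
      (∃ t : ℤ, ∀ m ∈ M, ∃ x ∈ M3, (m : ℤ) = x + t) ∧
      M1.card * (M2.card * M3.card) ≤ M.card * (4 * Q ^ 2) := by
  classical
  let f : ℕ × ℕ × ℕ → ℕ × ℕ := fun z => (z.1 + Q - z.2.1, z.1 + Q - z.2.2)
  let S := M1 ×ˢ (M2 ×ˢ M3)
  let T := Finset.range (2 * Q) ×ˢ Finset.range (2 * Q)
  have hf : ∀ z ∈ S, f z ∈ T := by
    rintro ⟨a, b, c⟩ hz
    simp only [S, Finset.mem_product] at hz
    have := h1 a hz.1
    simp only [T, f, Finset.mem_product, Finset.mem_range]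
    omega
  have hT : T.card = 4 * Q ^ 2 := by simp [T]; ring
  have hS : S.card = M1.card * (M2.card * M3.card) := by simp [S]
  have hTn : T.Nonempty := by
    rw [← Finset.card_pos, hT]; positivity
  obtain ⟨⟨u, v⟩, -, hy⟩ := Finset.exists_le_card_fiber_of_nsmul_le_card_of_maps_to
    (b := (S.card : ℝ) / T.card) hf hTn (by
      have : (T.card : ℝ) ≠ 0 := by exact_mod_cast hTn.card_pos.ne'
      rw [nsmul_eq_mul]
      field_simp
      exact le_rfl)
  set F := S.filter (fun z => f z = (u, v)) with hF
  have hprop : ∀ z ∈ F, z.1 ∈ M1 ∧ z.2.1 ∈ M2 ∧ z.2.2 ∈ M3 ∧ (z.1 : ℤ) = z.2.1 + (u - Q : ℤ) ∧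
      (z.1 : ℤ) = z.2.2 + (v - Q : ℤ) := by
    rintro ⟨a, b, c⟩ hz
    simp only [hF, S, f, Finset.mem_filter, Finset.mem_product, Prod.mk.injEq] at hz
    obtain ⟨⟨ha, hb, hc⟩, e1, e2⟩ := hz
    have := h2 b hb
    have := h3 c hc
    refine ⟨ha, hb, hc, ?_, ?_⟩ <;> dsimp only <;> omega
  refine ⟨F.image Prod.fst, ?_, ⟨u - Q, ?_⟩, ⟨v - Q, ?_⟩, ?_⟩
  · intro m hm
    obtain ⟨z, hz, rfl⟩ := Finset.mem_image.1 hm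
    exact (hprop z hz).1
  · intro m hm
    obtain ⟨z, hz, rfl⟩ := Finset.mem_image.1 hm
    exact ⟨_, (hprop z hz).2.1, (hprop z hz).2.2.2.1⟩
  · intro m hm
    obtain ⟨z, hz, rfl⟩ := Finset.mem_image.1 hm
    exact ⟨_, (hprop z hz).2.2.1, (hprop z hz).2.2.2.2⟩
  · rw [Finset.card_image_of_injOn, ← hS, ← hT]
    · rw [div_le_iff₀ (by exact_mod_cast hTn.card_pos)] at hy
      exact_mod_cast hy
    · rintro ⟨a, b, c⟩ hz ⟨a', b', c'⟩ hz' he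
      have g1 := hprop _ hz
      have g2 := hprop _ hz'
      simp only at g1 g2 he
      simp only [Prod.mk.injEq]
      omega

/-- The combinatorial core, with parameters `n` and `d`. -/
theorem core (μ n d q : ℕ) (hn1 : 2 ^ (n ^ 2 + 3 * n + 3) + 1 ≤ μ)
    (hn2 : μ + 5 ≤ 2 ^ (n ^ 2 + 5 * n + 8)) (hd1 : (μ + 5) ^ (d + 1) ≤ q)
    (hd2 : q ≤ (μ + 5) ^ (d + 2)) :
    ∃ M : Finset ℕ, (∀ m ∈ M, m ≤ (q - 1) / (μ + 5)) ∧
      q ≤ M.card * 2 ^ (24 * n * d + 24 * d + 2 * n ^ 2 + 10 * n + 18) ∧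
      (∀ m₁ ∈ M, ∀ m₂ ∈ M, ∀ m₃ ∈ M, ∀ m₄ ∈ M,
            2 * m₁ + 3 * m₂ + μ * m₃ = (μ + 5) * m₄ →
              m₁ = m₂ ∧ m₂ = m₃ ∧ m₃ = m₄) ∧
          (∀ m₁ ∈ M, ∀ m₂ ∈ M, ∀ m₃ ∈ M, ∀ m₄ ∈ M,
            5 * m₁ + (μ + 3) * m₂ = 3 * m₃ + (μ + 5) * m₄ →
              m₁ = m₂ ∧ m₂ = m₃ ∧ m₃ = m₄) ∧
          (∀ m₁ ∈ M, ∀ m₂ ∈ M, ∀ m₃ ∈ M, ∀ m₄ ∈ M,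
            5 * m₁ + μ * m₂ = 2 * m₃ + (μ + 3) * m₄ →
              m₁ = m₂ ∧ m₂ = m₃ ∧ m₃ = m₄) := by
  obtain ⟨A, hC, hA, hcard⟩ := exists_digits n
  have hA1 : ∀ a ∈ A, 6 * a < μ - 1 := by
    intro a ha
    have := hA a ha
    rw [pow_add] at hn1
    omega
  have hA2 : ∀ a ∈ A, 6 * a < μ + 1 := fun a ha => by have := hA1 a ha; omega
  have hA3 : ∀ a ∈ A, 6 * a < μ + 4 := fun a ha => by have := hA1 a ha; omega
  have hμ : 1 ≤ μ := le_trans (Nat.le_add_left 1 _) hn1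
  have b1 : (μ - 1) ^ d ≤ (μ + 5) ^ d := Nat.pow_le_pow_left (by omega) d
  have b2 : (μ + 1) ^ d ≤ (μ + 5) ^ d := Nat.pow_le_pow_left (by omega) d
  have b3 : (μ + 4) ^ d ≤ (μ + 5) ^ d := Nat.pow_le_pow_left (by omega) d
  obtain ⟨M, hM1, ⟨t2, hM2⟩, ⟨t3, hM3⟩, hMc⟩ := exists_inter (DigSet (μ - 1) A d)
    (DigSet (μ + 1) A d) (DigSet (μ + 4) A d) ((μ + 5) ^ d) (by positivity)
    (fun x hx => (digSet_lt _ A hA1 d x hx).trans_le b1)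
    (fun x hx => (digSet_lt _ A hA2 d x hx).trans_le b2)
    (fun x hx => (digSet_lt _ A hA3 d x hx).trans_le b3)
  rw [digSet_card _ A hA1, digSet_card _ A hA2, digSet_card _ A hA3] at hMc
  refine ⟨M, ?_, ?_, ?_, ?_, ?_⟩
  · intro m hm
    have := (digSet_lt _ A hA1 d m (hM1 hm)).trans_le b1
    rw [Nat.le_div_iff_mul_le (by omega)]
    have h2 : (m + 1) * (μ + 5) ≤ (μ + 5) ^ d * (μ + 5) := Nat.mul_le_mul_right _ this
    rw [← pow_succ, add_mul] at h2
    omega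
  · have hX : 0 < 2 ^ (3 * d * n ^ 2) := by positivity
    apply Nat.le_of_mul_le_mul_right _ hX
    have c1 : 2 ^ (3 * d * n ^ 2) ≤ A.card ^ d * (A.card ^ d * A.card ^ d) * 2 ^ (9 * n * d) := by
      calc 2 ^ (3 * d * n ^ 2) = (2 ^ (n ^ 2)) ^ (3 * d) := by rw [← pow_mul]; congr 1; ring
        _ ≤ (A.card * 2 ^ (3 * n)) ^ (3 * d) := Nat.pow_le_pow_left hcard _
        _ = _ := by rw [mul_pow, ← pow_mul]; congr 1 <;> ring
    calc q * 2 ^ (3 * d * n ^ 2)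
        ≤ (μ + 5) ^ (d + 2) * (A.card ^ d * (A.card ^ d * A.card ^ d) * 2 ^ (9 * n * d)) :=
          Nat.mul_le_mul hd2 c1
      _ ≤ (μ + 5) ^ (d + 2) * (M.card * (4 * ((μ + 5) ^ d) ^ 2) * 2 ^ (9 * n * d)) := by gcongr
      _ = M.card * (2 ^ 2 * (μ + 5) ^ (3 * d + 2) * 2 ^ (9 * n * d)) := by ring
      _ ≤ M.card * (2 ^ 2 * (2 ^ (n ^ 2 + 5 * n + 8)) ^ (3 * d + 2) * 2 ^ (9 * n * d)) := by
          gcongr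
      _ = _ := by
          rw [← pow_mul, ← pow_add, ← pow_add, mul_assoc M.card, ← pow_add]
          congr 2
          ring
  · intro m₁ h1 m₂ h2 m₃ h3 m₄ h4 he
    have := digSet_free (μ - 1) A hA1 hC 2 3 1 (by norm_num) (by norm_num) (by norm_num)
      (by norm_num) 0 0 (-1) d m₁ (hM1 h1) m₂ (hM1 h2) m₃ (hM1 h3) m₄ (hM1 h4) (by
        zify at he
        push_cast [hμ]
        linear_combination he)
    omega
  · intro m₁ h1 m₂ h2 m₃ h3 m₄ h4 he
    obtain ⟨x1, hx1, e1⟩ := hM3 m₁ h1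
    obtain ⟨x2, hx2, e2⟩ := hM3 m₂ h2
    obtain ⟨x3, hx3, e3⟩ := hM3 m₃ h3
    obtain ⟨x4, hx4, e4⟩ := hM3 m₄ h4
    have := digSet_free (μ + 4) A hA3 hC 1 3 1 (by norm_num) (by norm_num) (by norm_num)
      (by norm_num) 1 0 (-1) d x2 hx2 x3 hx3 x4 hx4 x1 hx1 (by
        zify at he
        rw [e1, e2, e3, e4] at he
        push_cast
        linear_combination -he)
    omega
  · intro m₁ h1 m₂ h2 m₃ h3 m₄ h4 he
    obtain ⟨x1, hx1, e1⟩ := hM2 m₁ h1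
    obtain ⟨x2, hx2, e2⟩ := hM2 m₂ h2
    obtain ⟨x3, hx3, e3⟩ := hM2 m₃ h3
    obtain ⟨x4, hx4, e4⟩ := hM2 m₄ h4
    have := digSet_free (μ + 1) A hA2 hC 1 2 2 (by norm_num) (by norm_num) (by norm_num)
      (by norm_num) 1 0 (-1) d x2 hx2 x3 hx3 x4 hx4 x1 hx1 (by
        zify at he
        rw [e1, e2, e3, e4] at he
        push_cast
        linear_combination -he)
    omega

/-- Choice of `n`. -/
theorem exists_n (μ : ℕ) (hμ : 9 ≤ μ) : ∃ n : ℕ, 2 ^ (n ^ 2 + 3 * n + 3) + 1 ≤ μ ∧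
    μ + 5 ≤ 2 ^ (n ^ 2 + 5 * n + 8) := by
  let P : ℕ → Prop := fun n => 2 ^ (n ^ 2 + 3 * n + 3) + 1 ≤ μ
  classical
  have h0 : P 0 := by simp [P]; omega
  have hP : P (Nat.findGreatest P μ) := Nat.findGreatest_spec (Nat.zero_le _) h0
  refine ⟨Nat.findGreatest P μ, hP, ?_⟩
  set n := Nat.findGreatest P μ with hn
  have hnot : ¬ P (n + 1) := by
    intro h
    have hle : n + 1 ≤ μ := by
      have h1 : (n + 1) ^ 2 + 3 * (n + 1) + 3 < 2 ^ ((n + 1) ^ 2 + 3 * (n + 1) + 3) :=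
        Nat.lt_two_pow_self
      have h2 : 2 ^ ((n + 1) ^ 2 + 3 * (n + 1) + 3) + 1 ≤ μ := h
      have h3 : 0 ≤ (n + 1) ^ 2 := by positivity
      omega
    have := Nat.le_findGreatest hle h
    omega
  have h2 : μ < 2 ^ ((n + 1) ^ 2 + 3 * (n + 1) + 3) + 1 := by simpa [P] using hnot
  have e : (n + 1) ^ 2 + 3 * (n + 1) + 3 = n ^ 2 + 5 * n + 7 := by ring
  rw [e] at h2
  have h3 : 2 ^ 7 ≤ 2 ^ (n ^ 2 + 5 * n + 7) := Nat.pow_le_pow_right (by norm_num) (by omega)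
  rw [show n ^ 2 + 5 * n + 8 = (n ^ 2 + 5 * n + 7) + 1 by ring, pow_succ 2 (n ^ 2 + 5 * n + 7)]
  omega

theorem expo_bound (n d x : ℝ) (hn0 : 0 ≤ n) (hd0 : 0 ≤ d) (hx2 : 2 ≤ x) (hnx : n ≤ x)
    (hdx : d ≤ 2 * x ^ 2) :
    24 * n * d + 24 * d + 2 * n ^ 2 + 10 * n + 18 ≤ 126 * x ^ 3 := by
  have i1 : n * d ≤ x * (2 * x ^ 2) := mul_le_mul hnx hdx hd0 (by linarith)
  have i2 : n ^ 2 ≤ x ^ 2 := pow_le_pow_left₀ hn0 hnx 2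
  have i3 : x ^ 2 ≤ x ^ 3 := pow_le_pow_right₀ (by linarith) (by norm_num)
  have i4 : x ≤ x ^ 2 := by nlinarith
  have i5 : x * (2 * x ^ 2) = 2 * x ^ 3 := by ring
  have i6 : 24 * n * d = 24 * (n * d) := by ring
  linarith

set_option maxHeartbeats 1000000 in
theorem stmt_5 :
    ∃ γ : ℝ, 0 < γ ∧ ∃ q₀ : ℕ, ∀ q : ℕ, q₀ ≤ q →
      ∀ μ : ℕ, μ = ⌈(2 : ℝ) ^ Real.sqrt (Real.log q)⌉₊ →
        ∃ M : Finset ℕ,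
          (∀ m ∈ M, m ≤ (q - 1) / (μ + 5)) ∧
          (q : ℝ) * Real.exp (-γ * (Real.log q) ^ ((3 : ℝ) / 4)) ≤ (M.card : ℝ) ∧
          (∀ m₁ ∈ M, ∀ m₂ ∈ M, ∀ m₃ ∈ M, ∀ m₄ ∈ M,
            2 * m₁ + 3 * m₂ + μ * m₃ = (μ + 5) * m₄ →
              m₁ = m₂ ∧ m₂ = m₃ ∧ m₃ = m₄) ∧
          (∀ m₁ ∈ M, ∀ m₂ ∈ M, ∀ m₃ ∈ M, ∀ m₄ ∈ M,
            5 * m₁ + (μ + 3) * m₂ = 3 * m₃ + (μ + 5) * m₄ →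
              m₁ = m₂ ∧ m₂ = m₃ ∧ m₃ = m₄) ∧
          (∀ m₁ ∈ M, ∀ m₂ ∈ M, ∀ m₃ ∈ M, ∀ m₄ ∈ M,
            5 * m₁ + μ * m₂ = 2 * m₃ + (μ + 3) * m₄ →
              m₁ = m₂ ∧ m₂ = m₃ ∧ m₃ = m₄) ∧
          (∀ m₁ ∈ M, ∀ m₂ ∈ M, ∀ m₃ ∈ M,
            2 * m₁ + 3 * m₂ = 5 * m₃ → m₁ = m₂ ∧ m₂ = m₃) ∧
          (∀ m₁ ∈ M, ∀ m₂ ∈ M, ∀ m₃ ∈ M,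
            5 * m₁ + μ * m₂ = (μ + 5) * m₃ → m₁ = m₂ ∧ m₂ = m₃) ∧
          (∀ m₁ ∈ M, ∀ m₂ ∈ M, ∀ m₃ ∈ M,
            2 * m₁ + (μ + 3) * m₂ = (μ + 5) * m₃ → m₁ = m₂ ∧ m₂ = m₃) ∧
          (∀ m₁ ∈ M, ∀ m₂ ∈ M, ∀ m₃ ∈ M,
            3 * m₁ + μ * m₂ = (μ + 3) * m₃ → m₁ = m₂ ∧ m₂ = m₃) := by
  refine ⟨126, by norm_num, ⌈Real.exp 16⌉₊, ?_⟩
  intro q hq μ hμ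
  have hq1 : Real.exp 16 ≤ q := Nat.ceil_le.1 hq
  have hqpos : (0 : ℝ) < q := (Real.exp_pos _).trans_le hq1
  set L := Real.log q with hL
  have hL16 : 16 ≤ L := (Real.le_log_iff_exp_le hqpos).2 hq1
  have hqL : (q : ℝ) = Real.exp L := (Real.exp_log hqpos).symm
  set x := L ^ ((1 : ℝ) / 4) with hx
  have hL0 : 0 ≤ L := by linarith
  have hx0 : 0 ≤ x := Real.rpow_nonneg hL0 _
  have hx4 : x ^ 4 = L := by
    rw [hx, ← Real.rpow_natCast, ← Real.rpow_mul hL0]; norm_num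
  have hx3 : L ^ ((3 : ℝ) / 4) = x ^ 3 := by
    rw [hx, ← Real.rpow_natCast, ← Real.rpow_mul hL0]; norm_num
  have hsq : Real.sqrt L = x ^ 2 := by
    rw [Real.sqrt_eq_iff_mul_self_eq hL0 (by positivity), ← hx4]; ring
  have hx2 : 2 ≤ x := by
    by_contra h
    push Not at h
    have : x ^ 4 < 2 ^ 4 := pow_lt_pow_left₀ h hx0 (by norm_num)
    linarith
  have hx24 : 4 ≤ x ^ 2 := by nlinarith
  rw [hsq] at hμ
  set Y := (2 : ℝ) ^ (x ^ 2) with hY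
  have hY16 : 16 ≤ Y := by
    have : (2 : ℝ) ^ (4 : ℝ) ≤ Y := Real.rpow_le_rpow_of_exponent_le (by norm_num) hx24
    norm_num at this
    exact this
  have hμ1 : Y ≤ μ := by rw [hμ]; exact Nat.le_ceil _
  have hμ2 : (μ : ℝ) < Y + 1 := by rw [hμ]; exact Nat.ceil_lt_add_one (by linarith)
  have hμ9 : 9 ≤ μ := by
    have : (9 : ℝ) ≤ μ := by linarith
    exact_mod_cast this
  obtain ⟨n, hn1, hn2⟩ := exists_n μ hμ9
  have hnx : (n : ℝ) ≤ x := by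
    have h1 : (2 : ℝ) ^ (n ^ 2 + 3 * n + 3) + 1 ≤ μ := by exact_mod_cast hn1
    have h2 : (2 : ℝ) ^ (n ^ 2) ≤ 2 ^ (n ^ 2 + 3 * n + 3) :=
      pow_le_pow_right₀ (by norm_num) (by omega)
    have h3 : (2 : ℝ) ^ ((n ^ 2 : ℕ) : ℝ) < Y := by
      rw [Real.rpow_natCast]; linarith
    have h4 := (Real.rpow_lt_rpow_left_iff (by norm_num : (1 : ℝ) < 2)).1 h3
    push_cast at h4
    exact (abs_le_of_sq_le_sq' h4.le hx0).2
  have hYe : Y = Real.exp (Real.log 2 * x ^ 2) := Real.rpow_def_of_pos (by norm_num) _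
  have hlog : (1 : ℝ) / 2 < Real.log 2 := by have := Real.log_two_gt_d9; linarith
  have hlog' : Real.log 2 < 1 := by have := Real.log_two_lt_d9; linarith
  have hY4 : Y ^ 4 ≤ q := by
    rw [hYe, ← Real.exp_nat_mul, hqL, ← hx4]
    apply Real.exp_le_exp.2
    push_cast
    nlinarith [mul_nonneg (sub_nonneg.2 hlog'.le) (sq_nonneg x)]
  have hNq : μ + 5 ≤ q := by
    have h1 : Y * 16 ≤ Y ^ 4 := by
      have : (16 : ℝ) ^ 3 ≤ Y ^ 3 := pow_le_pow_left₀ (by norm_num) hY16 3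
      nlinarith
    have : (μ : ℝ) + 5 ≤ q := by linarith
    exact_mod_cast this
  have hqn : q ≠ 0 := by omega
  have hlogpos : 0 < Nat.log (μ + 5) q := Nat.log_pos (by omega) hNq
  obtain ⟨d, hd⟩ : ∃ d, Nat.log (μ + 5) q = d + 1 := ⟨Nat.log (μ + 5) q - 1, by omega⟩
  have hd1 : (μ + 5) ^ (d + 1) ≤ q := by rw [← hd]; exact Nat.pow_log_le_self _ hqn
  have hd2 : q < (μ + 5) ^ (d + 2) := by
    have := Nat.lt_pow_succ_log_self (b := μ + 5) (by omega) q
    rwa [hd] at this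
  have hdx : (d : ℝ) ≤ 2 * x ^ 2 := by
    have h1 : Y ^ d ≤ q := by
      calc Y ^ d ≤ ((μ : ℝ) + 5) ^ d := pow_le_pow_left₀ (by linarith) (by linarith) d
        _ ≤ ((μ : ℝ) + 5) ^ (d + 1) := pow_le_pow_right₀ (by linarith) (by omega)
        _ ≤ q := by exact_mod_cast hd1
    rw [hYe, ← Real.exp_nat_mul, hqL, ← hx4] at h1
    have h2 := Real.exp_le_exp.1 h1
    have h3 : (d : ℝ) * Real.log 2 ≤ x ^ 2 := by
      have hp : 0 < x ^ 2 := by positivity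
      apply le_of_mul_le_mul_right _ hp
      linarith
    nlinarith [(Nat.cast_nonneg d : (0 : ℝ) ≤ d)]
  obtain ⟨M, hM, hcard, E1, E2, E3⟩ := core μ n d q hn1 hn2 hd1 hd2.le
  refine ⟨M, hM, ?_, E1, E2, E3, ?_, ?_, ?_, ?_⟩
  · rw [hx3]
    obtain ⟨E, hE⟩ : ∃ E, E = 24 * n * d + 24 * d + 2 * n ^ 2 + 10 * n + 18 := ⟨_, rfl⟩
    rw [← hE] at hcard
    have hEx : (E : ℝ) ≤ 126 * x ^ 3 := by
      rw [hE]
      push_cast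
      exact expo_bound n d x (Nat.cast_nonneg n) (Nat.cast_nonneg d) hx2 hnx hdx
    have h2E : (2 : ℝ) ^ E ≤ Real.exp (126 * x ^ 3) := by
      calc (2 : ℝ) ^ E ≤ (Real.exp 1) ^ E :=
            pow_le_pow_left₀ (by norm_num) (by have := Real.add_one_le_exp 1; linarith) _
        _ = Real.exp E := by rw [← Real.exp_nat_mul, mul_one]
        _ ≤ _ := Real.exp_le_exp.2 hEx
    have hc : (q : ℝ) ≤ M.card * 2 ^ E := by exact_mod_cast hcard
    rw [neg_mul, Real.exp_neg, ← div_eq_mul_inv, div_le_iff₀ (Real.exp_pos _)]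
    exact hc.trans (mul_le_mul_of_nonneg_left h2E (Nat.cast_nonneg _))
  · intro m₁ h1 m₂ h2 m₃ h3 he
    have := E1 m₁ h1 m₂ h2 m₃ h3 m₃ h3 (by linarith)
    omega
  · intro m₁ h1 m₂ h2 m₃ h3 he
    have := E1 m₁ h1 m₁ h1 m₂ h2 m₃ h3 (by linarith)
    omega
  · intro m₁ h1 m₂ h2 m₃ h3 he
    have := E1 m₁ h1 m₂ h2 m₂ h2 m₃ h3 (by linarith)
    omega
  · intro m₁ h1 m₂ h2 m₃ h3 he
    have := E3 m₁ h1 m₂ h2 m₁ h1 m₃ h3 (by linarith)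
    omega
end

section
/- Let k and q be positive integers and let V be the set of all k-tuples over the alphabet {1,...,q}. For 1 ≤ i ≤ k, let π_i : V → ({0,1,...,q})^k be the map that replaces the i-th coordinate of a tuple by 0 and leaves all other coordinates unchanged, and let π_0 be the identity map on V. Then for every subset S ⊆ V with |S| = t ≤ k + 1, at most t - 1 of the maps π_0, π_1, ..., π_k fail to be injective on S. -/
/-- Restricting to a set `D` of bad coordinates leaves at least `D.card + 1` tuples. -/
theorem bondy_aux {k : ℕ} (S : Finset (Fin k → ℕ)) (hne : S.Nonempty) (D : Finset (Fin k))
    (hD : ∀ i ∈ D, ∃ x ∈ S, ∃ y ∈ S, x i ≠ y i ∧ ∀ j, j ≠ i → x j = y j) :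
    D.card + 1 ≤ (S.image (fun x j => if j ∈ D then x j else 0)).card := by
  induction D using Finset.induction_on with
  | empty =>
    have := Finset.card_pos.2 (hne.image (fun x j => if j ∈ (∅ : Finset (Fin k)) then x j else 0))
    rw [Finset.card_empty, zero_add]
    exact this
  | insert i D hi ih =>
    have ih' := ih (fun j hj => hD j (Finset.mem_insert_of_mem hj))
    obtain ⟨x, hx, y, hy, hxy, hj⟩ := hD i (Finset.mem_insert_self i D)
    have e : S.image (fun x j => if j ∈ D then x j else 0) =
        (S.image (fun x j => if j ∈ insert i D then x j else 0)).image
          (fun x j => if j ∈ D then x j else 0) := by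
      rw [Finset.image_image]
      congr 1
      funext x j
      by_cases h : j ∈ D <;> simp [h]
    have hlt : (S.image (fun x j => if j ∈ D then x j else 0)).card <
        (S.image (fun x j => if j ∈ insert i D then x j else 0)).card := by
      rw [e]
      refine lt_of_le_of_ne Finset.card_image_le ?_
      intro h
      have hinj := Finset.card_image_iff.1 h
      have h2 := hinj (Finset.mem_coe.2 (Finset.mem_image_of_mem _ hx))
        (Finset.mem_coe.2 (Finset.mem_image_of_mem _ hy)) (by
          funext j
          by_cases h : j ∈ D
          · have : j ≠ i := fun e => hi (e ▸ h)
            simp [h, hj j this]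
          · simp [h])
      have h3 := congrFun h2 i
      simp at h3
      exact hxy h3
    rw [Finset.card_insert_of_notMem hi]
    omega

theorem stmt_7 (k q t : ℕ) (hk : 1 ≤ k) (hq : 1 ≤ q)
    (S : Finset (Fin k → ℕ)) (hS : ∀ x ∈ S, ∀ j : Fin k, 1 ≤ x j ∧ x j ≤ q)
    (hcard : S.card = t) (ht : t ≤ k + 1) :
    Set.ncard {i : Option (Fin k) |
        ¬ Set.InjOn
            (fun x : Fin k → ℕ => Option.elim i x (fun j => Function.update x j 0)) ↑S} ≤
      t - 1 := by
  classical
  let D : Finset (Fin k) := Finset.univ.filter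
    (fun i => ∃ x ∈ S, ∃ y ∈ S, x i ≠ y i ∧ ∀ j, j ≠ i → x j = y j)
  have hsub : {i : Option (Fin k) |
        ¬ Set.InjOn
            (fun x : Fin k → ℕ => Option.elim i x (fun j => Function.update x j 0)) ↑S} ⊆
      ((D.image some : Finset (Option (Fin k))) : Set (Option (Fin k))) := by
    intro i hi
    cases i with
    | none => exact absurd (fun x _ y _ h => h) hi
    | some i =>
      simp only [Set.mem_setOf_eq, Set.InjOn, Option.elim] at hi
      push Not at hi
      obtain ⟨x, hx, y, hy, hu, hne⟩ := hi
      have hj : ∀ j, j ≠ i → x j = y j := by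
        intro j hj
        have := congrFun hu j
        simpa [Function.update_of_ne hj] using this
      have hi' : x i ≠ y i := by
        intro h
        apply hne
        funext j
        by_cases e : j = i
        · rw [e, h]
        · exact hj j e
      simp only [Finset.coe_image, Set.mem_image, Finset.mem_coe]
      exact ⟨i, Finset.mem_filter.2 ⟨Finset.mem_univ _, x, hx, y, hy, hi', hj⟩, rfl⟩
  have h1 := Set.ncard_le_ncard hsub (Finset.finite_toSet _)
  rw [Set.ncard_coe_finset] at h1
  have h2 : (D.image some).card ≤ D.card := Finset.card_image_le
  have h3 : D.card ≤ S.card - 1 := by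
    rcases S.eq_empty_or_nonempty with h | h
    · have : D = ∅ := by
        apply Finset.filter_false_of_mem
        simp [h]
      simp [this]
    · have := bondy_aux S h D (fun i hi => (Finset.mem_filter.1 hi).2)
      have h4 := this.trans Finset.card_image_le
      omega
  omega
end

section
/- Let M be the N×n representation matrix of a PHF(N;n,q,t) with columns indexed by a set X of n words of length N over [q]. Then by deleting at most N·q columns from X, one obtains a subset X* ⊆ X with |X*| ≥ n - N·q such that no word x ∈ X* has a unique coordinate within X* (i.e., for every x ∈ X* and every coordinate i, there is another y ∈ X* with y(i) = x(i)). -/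
theorem stmt_9_aux (N n q : ℕ) (M : Fin N → Fin n → Fin q) (X : Finset (Fin n)) :
    ∃ Xs : Finset (Fin n),
      X.card ≤ Xs.card +
        ((Finset.univ ×ˢ X).image (fun p : Fin N × Fin n => (p.1, M p.1 p.2))).card ∧
      ∀ x ∈ Xs, ∀ i : Fin N, ∃ y ∈ Xs, y ≠ x ∧ M i y = M i x := by
  induction X using Finset.strongInduction with
  | H X ih =>
    by_cases hg : ∀ x ∈ X, ∀ i : Fin N, ∃ y ∈ X, y ≠ x ∧ M i y = M i x
    · exact ⟨X, by omega, hg⟩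
    · push Not at hg
      obtain ⟨x, hx, i, hu⟩ := hg
      obtain ⟨Xs, h1, h2⟩ := ih (X.erase x) (Finset.erase_ssubset hx)
      refine ⟨Xs, ?_, h2⟩
      have hlt : ((Finset.univ ×ˢ X.erase x).image
            (fun p : Fin N × Fin n => (p.1, M p.1 p.2))).card <
          ((Finset.univ ×ˢ X).image (fun p : Fin N × Fin n => (p.1, M p.1 p.2))).card := by
        apply Finset.card_lt_card
        rw [Finset.ssubset_iff_of_subset (Finset.image_subset_image
          (Finset.product_subset_product_right (Finset.erase_subset x X)))]
        refine ⟨(i, M i x), Finset.mem_image.2 ⟨(i, x), by simp [hx], rfl⟩, ?_⟩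
        intro hm
        obtain ⟨⟨j, y⟩, hy, he⟩ := Finset.mem_image.1 hm
        simp only [Finset.mem_product, Finset.mem_univ, true_and, Finset.mem_erase] at hy
        simp only [Prod.mk.injEq] at he
        obtain ⟨rfl, he⟩ := he
        exact hu y hy.2 hy.1 he
      have := Finset.card_erase_add_one hx
      omega

/-- From the representation matrix `M` of a `PHF(N; n, q, t)` (columns are `n`
distinct words), one can delete at most `N * q` columns so that in the remaining
set `X*` no column has a unique coordinate. -/
theorem stmt_9 (N n q t : ℕ) (M : Fin N → Fin n → Fin q)
    (hdist : ∀ x y : Fin n, (∀ i : Fin N, M i x = M i y) → x = y)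
    (hPHF : ∀ C : Finset (Fin n), C.card = t → ∃ i : Fin N, Set.InjOn (M i) ↑C) :
    ∃ Xs : Finset (Fin n),
      n - N * q ≤ Xs.card ∧
      ∀ x ∈ Xs, ∀ i : Fin N, ∃ y ∈ Xs, y ≠ x ∧ M i y = M i x := by
  obtain ⟨Xs, h1, h2⟩ := stmt_9_aux N n q M Finset.univ
  refine ⟨Xs, ?_, h2⟩
  have h3 := Finset.card_le_univ ((Finset.univ ×ˢ (Finset.univ : Finset (Fin n))).image
    (fun p : Fin N × Fin n => (p.1, M p.1 p.2)))
  simp only [Fintype.card_prod, Fintype.card_fin] at h3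
  simp only [Finset.card_univ, Fintype.card_fin] at h1
  omega
end

section
/- For every positive integer q, p_3*(3,q) ≤ f_3*(q,6,3) ≤ p_3(3,q). -/
/-- `M` is the representation matrix of a `PHF(N; n, q, t)`: `n` distinct columns
over `[q]` such that every `t` columns are separated by some row. -/
def IsPHFMat (N n q t : ℕ) (M : Fin N → Fin n → Fin q) : Prop :=
  (∀ x y : Fin n, (∀ i : Fin N, M i x = M i y) → x = y) ∧
  ∀ C : Finset (Fin n), C.card = t → ∃ i : Fin N, Set.InjOn (M i) ↑C

/-- `p_t(N, q)`: the maximal `n` for which a `PHF(N; n, q, t)` exists. -/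
noncomputable def pPHF (t N q : ℕ) : ℕ :=
  sSup {n | ∃ M : Fin N → Fin n → Fin q, IsPHFMat N n q t M}

/-- `p_t*(N, q)`: the maximal `n` for which a `PHF(N; n, q, t)` none of whose
columns has a unique coordinate exists. -/
noncomputable def pPHFstar (t N q : ℕ) : ℕ :=
  sSup {n | ∃ M : Fin N → Fin n → Fin q, IsPHFMat N n q t M ∧
    ∀ x : Fin n, ∀ i : Fin N, ∃ y : Fin n, y ≠ x ∧ M i y = M i x}

/-- `f_r*(q, v, e)`: the maximum number of edges in an `r`-uniform `r`-partite
hypergraph with all parts of size `q` (edges are transversals, one vertex per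
part) in which no `e` distinct edges span at most `v` vertices. -/
noncomputable def fStar (r q v e : ℕ) : ℕ :=
  sSup {n | ∃ E : Finset (Fin r → Fin q), E.card = n ∧
    ∀ E' ⊆ E, E'.card = e →
      v < (E'.biUnion fun f => Finset.univ.image fun i : Fin r => (i, f i)).card}

lemma span_card {q : ℕ} (E : Finset (Fin 3 → Fin q)) :
    (E.biUnion fun f => Finset.univ.image fun i : Fin 3 => (i, f i)).card
      = (E.image fun f => f 0).card + (E.image fun f => f 1).card + (E.image fun f => f 2).card := by
  have h : (E.biUnion fun f => Finset.univ.image fun i : Fin 3 => (i, f i))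
      = Finset.univ.biUnion fun i : Fin 3 => (E.image fun f => f i).image (Prod.mk i) := by
    ext ⟨a, b⟩
    simp only [Finset.mem_biUnion, Finset.mem_image, Finset.mem_univ, true_and, Prod.mk.injEq]
    constructor
    · rintro ⟨f, hf, i, rfl, rfl⟩
      exact ⟨i, _, ⟨f, hf, rfl⟩, rfl, rfl⟩
    · rintro ⟨i, _, ⟨f, hf, rfl⟩, rfl, rfl⟩
      exact ⟨f, hf, i, rfl, rfl⟩
  rw [h, Finset.card_biUnion]
  · simp_rw [Finset.card_image_of_injective _ (Prod.mk_right_injective _)]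
    rw [Fin.sum_univ_three]
  · intro i _ j _ hij
    refine Finset.disjoint_left.2 ?_
    rintro ⟨a, b⟩ h1 h2
    simp only [Finset.mem_image, Prod.mk.injEq] at h1 h2
    obtain ⟨_, _, rfl, _⟩ := h1
    obtain ⟨_, _, h3, _⟩ := h2
    exact hij h3.symm

lemma bdd_of_inj {q : ℕ} {n : ℕ} (M : Fin 3 → Fin n → Fin q)
    (h : ∀ x y : Fin n, (∀ i : Fin 3, M i x = M i y) → x = y) :
    Function.Injective (fun x i => M i x) := fun x y hxy => h x y (fun i => congrFun hxy i)

lemma card3 {q : ℕ} (a b c : Fin q) :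
    1 ≤ ({a, b, c} : Finset (Fin q)).card ∧
    ((a = b ∧ b = c) ∨ 2 ≤ ({a, b, c} : Finset (Fin q)).card) ∧
    (a ≠ b → a ≠ c → b ≠ c → ({a, b, c} : Finset (Fin q)).card = 3) := by
  refine ⟨Finset.card_pos.2 ⟨a, by simp⟩, ?_, fun h1 h2 h3 => Finset.card_eq_three.2 ⟨a, b, c, h1, h2, h3, rfl⟩⟩
  by_cases h : a = b
  · by_cases h' : b = c
    · exact Or.inl ⟨h, h'⟩
    · right
      exact Finset.one_lt_card.2 ⟨b, by simp, c, by simp, h'⟩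
  · right
    exact Finset.one_lt_card.2 ⟨a, by simp, b, by simp, h⟩

lemma star_pair {q n : ℕ} (M : Fin 3 → Fin n → Fin q) (hM : IsPHFMat 3 n q 3 M)
    (hu : ∀ x : Fin n, ∀ i : Fin 3, ∃ y : Fin n, y ≠ x ∧ M i y = M i x)
    (i : Fin 3) (x y : Fin n) (hxy : x ≠ y) (h : ∀ j, j ≠ i → M j x = M j y) : False := by
  obtain ⟨w, hwx, hw⟩ := hu x i
  have hwy : w ≠ y := by
    rintro rfl
    apply hxy
    apply hM.1
    intro j
    by_cases hj : j = i
    · subst hj; exact hw.symm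
    · exact h j hj
  obtain ⟨j, hj⟩ := hM.2 {w, x, y} (Finset.card_eq_three.2 ⟨w, x, y, hwx, hwy, hxy, rfl⟩)
  by_cases hji : j = i
  · subst hji
    exact hwx (hj (by simp) (by simp) hw)
  · exact hxy (hj (by simp) (by simp) (h j hji))

theorem stmt_11 (q : ℕ) (hq : 1 ≤ q) :
    pPHFstar 3 3 q ≤ fStar 3 q 6 3 ∧ fStar 3 q 6 3 ≤ pPHF 3 3 q := by
  constructor
  · apply csSup_le_csSup
    · refine ⟨Fintype.card (Fin 3 → Fin q), ?_⟩
      rintro n ⟨E, rfl, -⟩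
      exact Finset.card_le_univ E
    · refine ⟨0, fun _ x => x.elim0, ⟨fun x => x.elim0, ?_⟩, fun x => x.elim0⟩
      intro C hC
      have := Finset.card_le_univ C
      simp at this
      simp [this] at hC
    · rintro n ⟨M, hM, hu⟩
      have hinj := bdd_of_inj M hM.1
      refine ⟨Finset.univ.image (fun x i => M i x), ?_, ?_⟩
      · rw [Finset.card_image_of_injective _ hinj]; simp
      · intro E' hE' hc
        obtain ⟨f, g, h, hfg, hfh, hgh, rfl⟩ := Finset.card_eq_three.1 hc
        obtain ⟨x, -, rfl⟩ := Finset.mem_image.1 (hE' (show f ∈ _ by simp))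
        obtain ⟨y, -, rfl⟩ := Finset.mem_image.1 (hE' (show g ∈ _ by simp))
        obtain ⟨z, -, rfl⟩ := Finset.mem_image.1 (hE' (show h ∈ _ by simp))
        have hxy : x ≠ y := fun e => hfg (by rw [e])
        have hxz : x ≠ z := fun e => hfh (by rw [e])
        have hyz : y ≠ z := fun e => hgh (by rw [e])
        have key := star_pair M hM hu
        have key' : ∀ x y : Fin n, x ≠ y → ¬ (M 0 x = M 0 y ∧ M 1 x = M 1 y) ∧
            ¬ (M 0 x = M 0 y ∧ M 2 x = M 2 y) ∧ ¬ (M 1 x = M 1 y ∧ M 2 x = M 2 y) := by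
          intro x y hxy
          refine ⟨fun h => key 2 x y hxy ?_, fun h => key 1 x y hxy ?_, fun h => key 0 x y hxy ?_⟩ <;>
          · intro j hj
            fin_cases j <;> simp_all
        obtain ⟨i, hi⟩ := hM.2 {x, y, z} (Finset.card_eq_three.2 ⟨x, y, z, hxy, hxz, hyz, rfl⟩)
        have e1 : M i x ≠ M i y := fun e => hxy (hi (by simp) (by simp) e)
        have e2 : M i x ≠ M i z := fun e => hxz (hi (by simp) (by simp) e)
        have e3 : M i y ≠ M i z := fun e => hyz (hi (by simp) (by simp) e)
        rw [span_card]
        simp only [Finset.image_insert, Finset.image_singleton]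
        have k1 := key' x y hxy
        have k2 := key' x z hxz
        have k3 := key' y z hyz
        have c0 := card3 (M 0 x) (M 0 y) (M 0 z)
        have c1 := card3 (M 1 x) (M 1 y) (M 1 z)
        have c2 := card3 (M 2 x) (M 2 y) (M 2 z)
        clear hu key key' hi hc hE' hfg hfh hgh hinj hM
        generalize ({M 0 x, M 0 y, M 0 z} : Finset (Fin q)).card = a0 at *
        generalize ({M 1 x, M 1 y, M 1 z} : Finset (Fin q)).card = a1 at *
        generalize ({M 2 x, M 2 y, M 2 z} : Finset (Fin q)).card = a2 at *
        fin_cases i <;> simp only [Fin.zero_eta, Fin.mk_one, Fin.reduceFinMk] at e1 e2 e3 <;> grind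
  · apply csSup_le_csSup
    · refine ⟨Fintype.card (Fin 3 → Fin q), ?_⟩
      rintro n ⟨M, hM⟩
      simpa using Fintype.card_le_of_injective _ (bdd_of_inj M hM.1)
    · exact ⟨0, ∅, rfl, fun E' h hc => by simp [Finset.subset_empty.1 h] at hc⟩
    · rintro n ⟨E, rfl, hE⟩
      let e := E.equivFin.symm
      refine ⟨fun i x => (e x).1 i, ?_, ?_⟩
      · intro x y h
        exact e.injective (Subtype.ext (funext h))
      · intro C hC
        have hinj : Function.Injective (fun x => (e x).1) :=
          Subtype.val_injective.comp e.injective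
        have h := hE (C.image fun x => (e x).1) ?_ (by rw [Finset.card_image_of_injective _ hinj, hC])
        · rw [span_card] at h
          simp only [Finset.image_image] at h
          by_contra hcon
          push Not at hcon
          have hl : ∀ i : Fin 3, (C.image ((fun f : Fin 3 → Fin q => f i) ∘ fun x => (e x).1)).card < 3 := by
            intro i
            refine lt_of_le_of_ne (le_trans Finset.card_image_le hC.le) fun he => hcon i ?_
            exact Finset.card_image_iff.1 (he.trans hC.symm)
          have := hl 0
          have := hl 1
          have := hl 2
          omega
        · intro f hf
          obtain ⟨x, -, rfl⟩ := Finset.mem_image.1 hf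
          exact (e x).2
end

section
/- For every fixed t ≥ 3 and positive integers w_1,...,w_t with u = w_1 + ... + w_t, it holds that C(u, q, {w_1,...,w_t}) = o(q^2) as q → ∞. In particular, p_t(t,q) = o(q^2) for every fixed t ≥ 3. -/
open Finset in
/-- Greedy extension. -/
lemma greedy_ext {t N n q : ℕ} (w : Fin t → ℕ) (hN : N = ∑ i, w i)
    (F : Fin N → Fin n → Fin q) (B : Finset (Fin n))
    (hB : ∀ r, ∀ x ∈ B, N < #{y ∈ B | F r y = F r x}) (hN0 : 0 < N) :
    ∀ m : ℕ, ∀ (S : Finset (Fin n)) (c : Fin n → Fin t) (K : Finset (Fin N)),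
      N = m + #S → S ⊆ B → (∀ i, #{x ∈ S | c x = i} ≤ w i) → #S ≤ #K →
      (∀ r ∈ K, ∃ x ∈ S, ∃ y ∈ S, c x ≠ c y ∧ F r x = F r y) →
      (∃ x ∈ S, ∃ y ∈ S, c x ≠ c y) → ¬ IsSHF N n q w F := by
  intro m
  induction m with
  | zero =>
    intro S c K hm hSB hS hK hkill _ hF
    have hsum : #S = ∑ i, #{x ∈ S | c x = i} :=
      card_eq_sum_card_fiberwise (fun x _ => by simp)
    have heq : ∀ i, #{x ∈ S | c x = i} = w i := by
      have : ∑ i, #{x ∈ S | c x = i} = ∑ i, w i := by omega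
      have h2 := (Finset.sum_eq_sum_iff_of_le (fun i _ => hS i)).1 this
      exact fun i => h2 i (mem_univ i)
    have hKu : K = univ := by
      apply Finset.eq_univ_of_card
      have := card_le_univ K
      simp only [Fintype.card_fin] at this ⊢
      omega
    obtain ⟨r, hr⟩ := hF (fun i => {x ∈ S | c x = i}) (by
      intro i j hij
      rw [Finset.disjoint_left]
      intro a ha hb
      simp only [mem_filter] at ha hb
      exact hij (ha.2.symm.trans hb.2)) heq
    obtain ⟨x, hx, y, hy, hxy, hf⟩ := hkill r (by simp [hKu])
    exact hr (c x) (c y) hxy x (by simp [hx]) y (by simp [hy]) hf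
  | succ m ih =>
    intro S c K hm hSB hS hK hkill h2
    have hsum : #S = ∑ i, #{x ∈ S | c x = i} :=
      card_eq_sum_card_fiberwise (fun x _ => by simp)
    obtain ⟨i, hi⟩ : ∃ i, #{x ∈ S | c x = i} < w i := by
      by_contra! h
      have : ∑ i, w i ≤ ∑ i, #{x ∈ S | c x = i} := Finset.sum_le_sum (fun i _ => h i)
      omega
    obtain ⟨x, hx, hxi⟩ : ∃ x ∈ S, c x ≠ i := by
      obtain ⟨x, hx, y, hy, hxy⟩ := h2
      by_cases h : c x = i
      · exact ⟨y, hy, fun h' => hxy (h.trans h'.symm)⟩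
      · exact ⟨x, hx, h⟩
    obtain ⟨r, hr⟩ : ∃ r, #S + 1 ≤ #(insert r K) := by
      by_cases h : K = univ
      · refine ⟨⟨0, hN0⟩, ?_⟩
        have : insert (⟨0, hN0⟩ : Fin N) K = univ := by simp [h]
        rw [this, card_univ, Fintype.card_fin]
        omega
      · obtain ⟨r, hr⟩ : ∃ r, r ∉ K := by
          by_contra! h'
          exact h (by ext; simp [h'])
        refine ⟨r, ?_⟩
        rw [card_insert_of_notMem hr]
        omega
    obtain ⟨y, hy, hyS⟩ : ∃ y ∈ ({y ∈ B | F r y = F r x} : Finset (Fin n)), y ∉ S := by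
      apply Finset.exists_mem_notMem_of_card_lt_card
      have := hB r x (hSB hx)
      omega
    simp only [mem_filter] at hy
    have hne : ∀ z ∈ S, Function.update c y i z = c z := by
      intro z hz
      apply Function.update_of_ne
      rintro rfl
      exact hyS hz
    have hkill' : ∀ r ∈ K, ∃ a ∈ insert y S, ∃ b ∈ insert y S,
        Function.update c y i a ≠ Function.update c y i b ∧ F r a = F r b := by
      intro r hr
      obtain ⟨a, ha, b, hb, hab, hf⟩ := hkill r hr
      refine ⟨a, by simp [ha], b, by simp [hb], ?_, hf⟩
      rwa [hne a ha, hne b hb]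
    refine ih (insert y S) (Function.update c y i) (insert r K) ?_ ?_ ?_ ?_ ?_ ?_
    · rw [card_insert_of_notMem hyS]; omega
    · exact insert_subset hy.1 hSB
    · intro j
      have hfil : ({z ∈ S | Function.update c y i z = j} : Finset (Fin n)) = {z ∈ S | c z = j} := by
        apply filter_congr
        intro z hz
        rw [hne z hz]
      rw [filter_insert, hfil]
      split_ifs with h
      · rw [Function.update_self] at h
        subst h
        have := card_insert_le y {z ∈ S | c z = i}
        omega
      · exact hS j
    · rw [card_insert_of_notMem hyS]; exact hr
    · intro r' hr'
      rcases mem_insert.1 hr' with rfl | h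
      · refine ⟨x, by simp [hx], y, by simp, ?_, hy.2.symm⟩
        rw [hne x hx, Function.update_self]
        exact hxi
      · exact hkill' r' h
    · refine ⟨x, by simp [hx], y, by simp, ?_⟩
      rw [hne x hx, Function.update_self]
      exact hxi

open Finset in
/-- Cleaning: pass to a large subset where all nonempty fibres are large. -/
lemma cleaning {N n q : ℕ} (F : Fin N → Fin n → Fin q) :
    ∃ B : Finset (Fin n), n ≤ #B + (N + 1) * (N * q) ∧
      ∀ r, ∀ x ∈ B, N < #{y ∈ B | F r y = F r x} := by
  let φ : Finset (Fin n) → Finset (Fin N × Fin q) := fun A =>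
    univ.filter (fun p => ∃ x ∈ A, F p.1 x = p.2)
  obtain ⟨B, -, hB⟩ := Finset.exists_max_image (univ : Finset (Finset (Fin n)))
    (fun A => (#A : ℤ) - (N + 1) * #(φ A)) ⟨∅, mem_univ _⟩
  refine ⟨B, ?_, ?_⟩
  · have h := hB univ (mem_univ _)
    have h1 : #(φ univ) ≤ N * q := by
      refine (card_le_univ _).trans ?_
      simp
    have h2 : ((N : ℤ) + 1) * #(φ univ) ≤ (N + 1) * (N * q) := by
      have : (#(φ univ) : ℤ) ≤ N * q := by exact_mod_cast h1
      gcongr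
    have h3 : 0 ≤ ((N : ℤ) + 1) * #(φ B) := by positivity
    simp only [card_univ, Fintype.card_fin] at h
    zify
    linarith
  · intro r x hx
    by_contra! hle
    have h := hB {y ∈ B | ¬ F r y = F r x} (mem_univ _)
    have hc := card_filter_add_card_filter_not (s := B) (fun y => F r y = F r x)
    have hφ : #(φ {y ∈ B | ¬ F r y = F r x}) < #(φ B) := by
      apply card_lt_card
      rw [Finset.ssubset_iff_of_subset]
      · refine ⟨(r, F r x), ?_, ?_⟩
        · simp only [φ, mem_filter, mem_univ, true_and]
          exact ⟨x, hx, rfl⟩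
        · simp only [φ, mem_filter, mem_univ, true_and]
          rintro ⟨z, ⟨_, hz⟩, hz'⟩
          exact hz hz'
      · intro p
        simp only [φ, mem_filter, mem_univ, true_and]
        rintro ⟨z, ⟨hz, _⟩, hz'⟩
        exact ⟨z, hz, hz'⟩
    have h2 : ((N : ℤ) + 1) * (#(φ {y ∈ B | ¬ F r y = F r x}) + 1) ≤ (N + 1) * #(φ B) := by
      have : (#(φ {y ∈ B | ¬ F r y = F r x}) : ℤ) + 1 ≤ #(φ B) := by exact_mod_cast hφ
      gcongr
    have h3 : (#B : ℤ) ≤ N + #{y ∈ B | ¬ F r y = F r x} := by exact_mod_cast (by omega)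
    nlinarith

open Finset SimpleGraph TripartiteFromTriangles in
lemma tri_bound (ε : ℝ) (hε : 0 < ε) : ∃ Q : ℕ, ∀ q ≥ Q, ∀ (n : ℕ) (B : Finset (Fin n))
    (f g h : Fin n → Fin q),
    (∀ x ∈ B, ∀ y ∈ B, f x = f y → g x = g y → x = y) →
    (∀ x ∈ B, ∀ y ∈ B, f x = f y → h x = h y → x = y) →
    (∀ x ∈ B, ∀ y ∈ B, g x = g y → h x = h y → x = y) →
    (∀ x ∈ B, ∀ y ∈ B, ∀ z ∈ B, x ≠ y → x ≠ z → y ≠ z →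
      f y = f z → g x = g z → h x = h y → False) → (#B : ℝ) ≤ ε * q ^ 2 := by
  have hb : 0 < triangleRemovalBound (ε / 9) := triangleRemovalBound_pos (by positivity)
  obtain ⟨Q, hQ⟩ := exists_nat_gt (1 / (triangleRemovalBound (ε / 9) * 27))
  refine ⟨Q, ?_⟩
  intro q hq n B f g h hfg hfh hgh htri
  by_contra! hlt
  have hqQ : 1 / (triangleRemovalBound (ε / 9) * 27) < (q : ℝ) :=
    hQ.trans_le (by exact_mod_cast hq)
  have hq0 : (0 : ℝ) < q := lt_trans (by positivity) hqQ
  let T : Finset (Fin q × Fin q × Fin q) := B.image (fun x => (f x, g x, h x))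
  have hTc : #T = #B := by
    apply card_image_of_injOn
    intro x hx y hy hxy
    simp only [Prod.mk.injEq] at hxy
    exact hfg x hx y hy hxy.1 hxy.2.1
  have hT : ∀ a b c, (a, b, c) ∈ T ↔ ∃ x ∈ B, f x = a ∧ g x = b ∧ h x = c := by
    intro a b c
    simp [T]
  have hBq : #B ≤ q ^ 2 := by
    have : #(B.image (fun x => (f x, g x))) = #B := by
      apply card_image_of_injOn
      intro x hx y hy hxy
      simp only [Prod.mk.injEq] at hxy
      exact hfg x hx y hy hxy.1 hxy.2
    rw [← this]
    refine (card_le_univ _).trans ?_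
    simp [sq]
  have : ExplicitDisjoint T := by
    constructor
    · intro a b c a' h1 h2
      obtain ⟨x, hx, rfl, rfl, rfl⟩ := (hT _ _ _).1 h1
      obtain ⟨y, hy, rfl, h3, h4⟩ := (hT _ _ _).1 h2
      rw [hgh y hy x hx h3 h4]
    · intro a b c a' h1 h2
      obtain ⟨x, hx, rfl, rfl, rfl⟩ := (hT _ _ _).1 h1
      obtain ⟨y, hy, h3, rfl, h4⟩ := (hT _ _ _).1 h2
      rw [hfh y hy x hx h3 h4]
    · intro a b c a' h1 h2
      obtain ⟨x, hx, rfl, rfl, rfl⟩ := (hT _ _ _).1 h1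
      obtain ⟨y, hy, h3, h4, rfl⟩ := (hT _ _ _).1 h2
      rw [hfg y hy x hx h3 h4]
  have : NoAccidental T := by
    constructor
    intro a a' b b' c c' h1 h2 h3
    obtain ⟨x, hx, hx1, hx2, hx3⟩ := (hT _ _ _).1 h1
    obtain ⟨y, hy, hy1, hy2, hy3⟩ := (hT _ _ _).1 h2
    obtain ⟨z, hz, hz1, hz2, hz3⟩ := (hT _ _ _).1 h3
    by_contra! hne
    refine htri x hx y hy z hz ?_ ?_ ?_ (hy1.trans hz1.symm) (hx2.trans hz2.symm)
      (hx3.trans hy3.symm)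
    · rintro rfl; exact hne.1 (hy1.symm.trans hx1)
    · rintro rfl; exact hne.1 (hz1.symm.trans hx1)
    · rintro rfl; exact hne.2.1 (hz2.symm.trans hy2)
  have hfar : (graph T).FarFromTriangleFree (ε / 9) := by
    refine farFromTriangleFree _ ?_
    rw [hTc]
    simp only [Fintype.card_fin]
    push_cast
    nlinarith
  have h1 := hfar.le_card_cliqueFinset
  rw [card_triangles, hTc] at h1
  have h2 : (#B : ℝ) ≤ q ^ 2 := by exact_mod_cast hBq
  have h3 := h1.trans h2
  simp only [Fintype.card_sum, Fintype.card_fin] at h3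
  push_cast at h3
  rw [div_lt_iff₀ (by positivity)] at hqQ
  have h4 : (q : ℝ) ^ 2 * 1 < q ^ 2 * (q * (triangleRemovalBound (ε / 9) * 27)) := by
    gcongr
  nlinarith

open Finset in
lemma main_bound {t : ℕ} (ht : 3 ≤ t) (w : Fin t → ℕ) (hw : ∀ i, 1 ≤ w i) (N : ℕ)
    (hN : N = ∑ i, w i) (ε : ℝ) (hε : 0 < ε) :
    ∃ Q : ℕ, ∀ q ≥ Q, ∀ n, ∀ F : Fin N → Fin n → Fin q, IsSHF N n q w F →
      (n : ℝ) ≤ ε * q ^ 2 := by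
  have htN : t ≤ N := by
    have : ∑ i : Fin t, 1 ≤ ∑ i, w i := Finset.sum_le_sum (fun i _ => hw i)
    simp at this
    omega
  obtain ⟨Q, hQ⟩ := tri_bound (ε / 2) (by positivity)
  obtain ⟨Q', hQ'⟩ := exists_nat_ge (((N : ℝ) + 1) * N / (ε / 2))
  refine ⟨max Q Q', ?_⟩
  intro q hq n F hF
  obtain ⟨B, hBn, hB⟩ := cleaning F
  -- colour classes
  let i0 : Fin t := ⟨0, by omega⟩
  let i1 : Fin t := ⟨1, by omega⟩
  let i2 : Fin t := ⟨2, by omega⟩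
  have h01 : i0 ≠ i1 := by simp [i0, i1]
  have h02 : i0 ≠ i2 := by simp [i0, i2]
  have h12 : i1 ≠ i2 := by simp [i1, i2]
  let r0 : Fin N := ⟨0, by omega⟩
  let r1 : Fin N := ⟨1, by omega⟩
  let r2 : Fin N := ⟨2, by omega⟩
  have k01 : r0 ≠ r1 := by simp [r0, r1]
  have k02 : r0 ≠ r2 := by simp [r0, r2]
  have k12 : r1 ≠ r2 := by simp [r1, r2]
  have hpair : ∀ r r' : Fin N, r ≠ r' → ∀ x ∈ B, ∀ y ∈ B, F r x = F r y → F r' x = F r' y →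
      x = y := by
    intro r r' hr x hx y hy h1 h2
    by_contra hxy
    have hc2 : #({x, y} : Finset (Fin n)) = 2 := card_pair hxy
    refine greedy_ext w hN F B hB (by omega) (N - 2) {x, y} (fun a => if a = x then i0 else i1)
      {r, r'} ?_ ?_ ?_ ?_ ?_ ?_ hF
    · omega
    · intro a; simp only [mem_insert, mem_singleton]; rintro (rfl | rfl) <;> assumption
    · intro i
      refine le_trans (card_le_one.2 ?_) (hw i)
      intro a ha b hb
      simp only [mem_filter, mem_insert, mem_singleton] at ha hb
      grind
    · rw [card_pair hxy, card_pair hr]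
    · intro s hs
      refine ⟨x, by simp, y, by simp, by grind, by grind⟩
    · refine ⟨x, by simp, y, by simp, by grind⟩
  have hBq : (#B : ℝ) ≤ ε / 2 * q ^ 2 := by
    refine hQ q ((le_max_left _ _).trans hq) n B (F r0) (F r1) (F r2) (hpair _ _ k01)
      (hpair _ _ k02) (hpair _ _ k12) ?_
    intro x hx y hy z hz hxy hxz hyz e0 e1 e2
    have hc3 : #({x, y, z} : Finset (Fin n)) = 3 := card_eq_three.2 ⟨x, y, z, hxy, hxz, hyz, rfl⟩
    have hk3 : #({r0, r1, r2} : Finset (Fin N)) = 3 :=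
      card_eq_three.2 ⟨r0, r1, r2, k01, k02, k12, rfl⟩
    refine greedy_ext w hN F B hB (by omega) (N - 3) {x, y, z}
      (fun a => if a = x then i0 else if a = y then i1 else i2)
      {r0, r1, r2} ?_ ?_ ?_ ?_ ?_ ?_ hF
    · omega
    · intro a; simp only [mem_insert, mem_singleton]; rintro (rfl | rfl | rfl) <;> assumption
    · intro i
      refine le_trans (card_le_one.2 ?_) (hw i)
      intro a ha b hb
      simp only [mem_filter, mem_insert, mem_singleton] at ha hb
      grind
    · rw [hc3, hk3]
    · intro s hs
      simp only [mem_insert, mem_singleton] at hs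
      rcases hs with rfl | rfl | rfl
      · exact ⟨y, by simp, z, by simp, by grind, e0⟩
      · exact ⟨x, by simp, z, by simp, by grind, e1⟩
      · exact ⟨x, by simp, y, by simp, by grind, e2⟩
    · exact ⟨x, by simp, y, by simp, by grind⟩
  have hqQ' : ((N : ℝ) + 1) * N / (ε / 2) ≤ q :=
    hQ'.trans (by exact_mod_cast (le_max_right _ _).trans hq)
  rw [div_le_iff₀ (by positivity)] at hqQ'
  have h1 : (n : ℝ) ≤ #B + (N + 1) * (N * q) := by exact_mod_cast hBn
  have h2 : ((N : ℝ) + 1) * N * q ≤ q * (ε / 2) * q := by gcongr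
  nlinarith

lemma phf_to_shf {t n q : ℕ} (M : Fin t → Fin n → Fin q) (h : IsPHFMat t n q t M) :
    IsSHF t n q (fun _ : Fin t => 1) M := by
  intro C hd hc
  obtain ⟨r, hr⟩ := h.2 (Finset.univ.biUnion C) (by
    rw [Finset.card_biUnion (fun i _ j _ hij => hd i j hij)]
    simp [hc])
  refine ⟨r, ?_⟩
  intro i j hij x hx y hy hxy
  have : x = y := hr (by simp; exact ⟨i, hx⟩) (by simp; exact ⟨j, hy⟩) hxy
  subst this
  exact Finset.disjoint_left.1 (hd i j hij) hx hy

lemma tendsto_of_bound (S : ℕ → Set ℕ)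
    (h : ∀ ε : ℝ, 0 < ε → ∃ Q : ℕ, ∀ q ≥ Q, ∀ n ∈ S q, (n : ℝ) ≤ ε * q ^ 2) :
    Filter.Tendsto (fun q : ℕ => ((sSup (S q) : ℕ) : ℝ) / (q : ℝ) ^ 2)
      Filter.atTop (nhds 0) := by
  rw [Metric.tendsto_atTop]
  intro ε hε
  obtain ⟨Q, hQ⟩ := h (ε / 2) (by positivity)
  refine ⟨max Q 1, fun q hq => ?_⟩
  have hq1 : (0 : ℝ) < q := by exact_mod_cast (le_max_right _ _).trans hq
  have hle : ((sSup (S q) : ℕ) : ℝ) ≤ ε / 2 * q ^ 2 := by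
    rcases Set.eq_empty_or_nonempty (S q) with h0 | h0
    · rw [h0]; simp; positivity
    · refine hQ q ((le_max_left _ _).trans hq) _ (Nat.sSup_mem h0 ?_)
      refine ⟨⌊ε / 2 * q ^ 2⌋₊, fun n hn => ?_⟩
      exact Nat.le_floor (hQ q ((le_max_left _ _).trans hq) n hn)
  rw [Real.dist_eq, sub_zero, abs_of_nonneg (by positivity), div_lt_iff₀ (by positivity)]
  have : 0 < ε / 2 * (q : ℝ) ^ 2 := by positivity
  nlinarith

theorem stmt_13 {t : ℕ} (ht : 3 ≤ t) (w : Fin t → ℕ) (hw : ∀ i, 1 ≤ w i) :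
    Filter.Tendsto (fun q : ℕ => (maxSHF (∑ i, w i) q w : ℝ) / (q : ℝ) ^ 2)
      Filter.atTop (nhds 0) ∧
    Filter.Tendsto (fun q : ℕ => (pPHF t t q : ℝ) / (q : ℝ) ^ 2)
      Filter.atTop (nhds 0) := by
  constructor
  · refine tendsto_of_bound
      (fun q => {n | ∃ F : Fin (∑ i, w i) → Fin n → Fin q, IsSHF (∑ i, w i) n q w F}) ?_
    intro ε hε
    obtain ⟨Q, hQ⟩ := main_bound ht w hw _ rfl ε hε
    refine ⟨Q, fun q hq n hn => ?_⟩
    obtain ⟨F, hF⟩ := hn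
    exact hQ q hq n F hF
  · refine tendsto_of_bound
      (fun q => {n | ∃ M : Fin t → Fin n → Fin q, IsPHFMat t n q t M}) ?_
    intro ε hε
    obtain ⟨Q, hQ⟩ := main_bound ht (fun _ => 1) (fun _ => le_rfl) t (by simp) ε hε
    refine ⟨Q, fun q hq n hn => ?_⟩
    obtain ⟨M, hM⟩ := hn
    exact hQ q hq n M (phf_to_shf M hM)
end

section
/- There exists a constant γ > 0 such that for all sufficiently large q, p_3(3,q) > q^2·e^{-γ√(log q)}. -/
lemma phf_core (x1 a1 x2 a2 x3 a3 : ℕ)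
    (h12 : ¬ (x1 = x2 ∧ a1 = a2)) (h13 : ¬ (x1 = x3 ∧ a1 = a3)) (h23 : ¬ (x2 = x3 ∧ a2 = a3))
    (p1 : a2 + a3 = a1 + a1 → a2 = a1) (p2 : a1 + a3 = a2 + a2 → a1 = a2)
    (p3 : a1 + a2 = a3 + a3 → a1 = a3)
    (e0 : x1 = x2 ∨ x1 = x3 ∨ x2 = x3)
    (e1 : x1 + a1 = x2 + a2 ∨ x1 + a1 = x3 + a3 ∨ x2 + a2 = x3 + a3)
    (e2 : x1 + 2 * a1 = x2 + 2 * a2 ∨ x1 + 2 * a1 = x3 + 2 * a3 ∨ x2 + 2 * a2 = x3 + 2 * a3) :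
    False := by
  rcases e0 with e0 | e0 | e0 <;> rcases e1 with e1 | e1 | e1 <;>
    rcases e2 with e2 | e2 | e2 <;> omega

lemma phf_injOn {α β : Type*} [DecidableEq α] (f : α → β) (u v w : α)
    (h : ¬ (f u = f v ∨ f u = f w ∨ f v = f w)) :
    Set.InjOn f (({u, v, w} : Finset α) : Set α) := by
  push Not at h
  obtain ⟨h1, h2, h3⟩ := h
  intro a ha b hb hab
  simp only [Finset.coe_insert, Finset.coe_singleton, Set.mem_insert_iff,
    Set.mem_singleton_iff] at ha hb
  rcases ha with rfl | rfl | rfl <;> rcases hb with rfl | rfl | rfl <;> simp_all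

lemma phf_bdd (q : ℕ) : BddAbove {n | ∃ M : Fin 3 → Fin n → Fin q, IsPHFMat 3 n q 3 M} := by
  refine ⟨q ^ 3, ?_⟩
  rintro n ⟨M, hM, -⟩
  have := Fintype.card_le_of_injective (fun (c : Fin n) (i : Fin 3) => M i c)
    (fun x y h => hM x y (fun i => congrFun h i))
  simpa using this

lemma phf_constr (q m : ℕ) (hm : 3 * m ≤ q) : m * rothNumberNat m ≤ pPHF 3 3 q := by
  obtain ⟨A, hA, hcard, hfree⟩ := rothNumberNat_spec m
  apply le_csSup (phf_bdd q)
  have hc : Fintype.card (Fin m × A) = m * rothNumberNat m := by simp [hcard]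
  let e : Fin (m * rothNumberNat m) ≃ Fin m × A := (Fintype.equivFinOfCardEq hc).symm
  let X : Fin (m * rothNumberNat m) → ℕ := fun c => (e c).1
  let a : Fin (m * rothNumberNat m) → ℕ := fun c => (e c).2
  have hX : ∀ c, X c < m := fun c => (e c).1.2
  have haA : ∀ c, a c ∈ A := fun c => (e c).2.2
  have ha : ∀ c, a c < m := fun c => Finset.mem_range.1 (hA (haA c))
  have hinj : ∀ c d, X c = X d ∧ a c = a d → c = d := by
    rintro c d ⟨h1, h2⟩
    exact e.injective (Prod.ext (Fin.ext h1) (Subtype.ext h2))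
  have hap : ∀ c d f, a c + a f = a d + a d → a c = a d := fun c d f h =>
    hfree (haA c) (haA d) (haA f) h
  clear_value X a
  refine ⟨fun i c => ⟨X c + i * a c, ?_⟩, ?_, ?_⟩
  · have := hX c
    have := ha c
    have : (i : ℕ) * a c ≤ 2 * a c := Nat.mul_le_mul_right _ (by omega)
    omega
  · intro x y h
    have h0 := h 0
    have h1 := h 1
    simp at h0 h1
    exact hinj x y ⟨h0, by omega⟩
  · intro C hC
    obtain ⟨u, v, w, huv, huw, hvw, rfl⟩ := Finset.card_eq_three.1 hC
    by_contra! hcon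
    have key := fun i => not_imp_comm.1 (phf_injOn _ u v w) (hcon i)
    have k0 := key 0
    have k1 := key 1
    have k2 := key 2
    simp at k0 k1 k2
    exact phf_core (X u) (a u) (X v) (a v) (X w) (a w)
      (fun h => huv (hinj _ _ h)) (fun h => huw (hinj _ _ h)) (fun h => hvw (hinj _ _ h))
      (hap _ _ _) (hap _ _ _) (hap _ _ _) k0 k1 k2

theorem stmt_14 :
    ∃ γ : ℝ, 0 < γ ∧ ∃ q₀ : ℕ, ∀ q : ℕ, q₀ ≤ q →
      (q : ℝ) ^ 2 * Real.exp (-γ * Real.sqrt (Real.log q)) < (pPHF 3 3 q : ℝ) := by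
  refine ⟨5, by norm_num, max 12 ⌈Real.exp 16⌉₊, fun q hq => ?_⟩
  have hq12 : 12 ≤ q := le_trans (le_max_left _ _) hq
  have hqe : Real.exp 16 ≤ q := (Nat.le_ceil _).trans (by exact_mod_cast le_trans (le_max_right _ _) hq)
  have hq0 : (0 : ℝ) < q := by positivity
  have hlog : 16 ≤ Real.log q := (Real.le_log_iff_exp_le hq0).2 hqe
  have hs : 4 ≤ Real.sqrt (Real.log q) := Real.le_sqrt_of_sq_le (by linarith)
  obtain ⟨m, hm⟩ : ∃ m, m = q / 3 := ⟨_, rfl⟩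
  have h3 : 3 * m ≤ q := by omega
  have h4 : q ≤ 4 * m := by omega
  have h4' : (q : ℝ) / 4 ≤ m := by
    have : (q : ℝ) ≤ 4 * m := by exact_mod_cast h4
    linarith
  have hm0 : (0 : ℝ) < m := by linarith
  have hmq : (m : ℝ) ≤ q := by exact_mod_cast (by omega : m ≤ q)
  have h1 : ((m : ℝ) * rothNumberNat m) ≤ pPHF 3 3 q := by exact_mod_cast phf_constr q m h3
  have h2 := Behrend.roth_lower_bound (N := m)
  have hsm : Real.sqrt (Real.log m) ≤ Real.sqrt (Real.log q) :=
    Real.sqrt_le_sqrt (Real.log_le_log hm0 hmq)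
  set s := Real.sqrt (Real.log q)
  have he : Real.exp (-4 * s) ≤ Real.exp (-4 * Real.sqrt (Real.log m)) :=
    Real.exp_le_exp.2 (by linarith)
  have h16 : 16 * Real.exp (-s) < 1 := by
    have e1 : (16 : ℝ) < Real.exp s := by
      have e2 : Real.exp 4 ≤ Real.exp s := Real.exp_le_exp.2 hs
      have e3 : Real.exp 4 = Real.exp 1 ^ 4 := by rw [← Real.exp_nat_mul]; norm_num
      have e4 : (2 : ℝ) ^ 4 < Real.exp 1 ^ 4 :=
        pow_lt_pow_left₀ (by linarith [Real.exp_one_gt_d9]) (by norm_num) (by norm_num)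
      linarith
    rw [Real.exp_neg, ← div_eq_mul_inv, div_lt_one (Real.exp_pos s)]
    exact e1
  have hsplit : Real.exp (-5 * s) = Real.exp (-4 * s) * Real.exp (-s) := by
    rw [← Real.exp_add]; ring_nf
  calc (q : ℝ) ^ 2 * Real.exp (-5 * s)
      = ((q : ℝ) / 4 * (q / 4 * Real.exp (-4 * s))) * (16 * Real.exp (-s)) := by
        rw [hsplit]; ring
    _ < ((q : ℝ) / 4 * (q / 4 * Real.exp (-4 * s))) * 1 :=
        mul_lt_mul_of_pos_left h16 (by positivity)
    _ ≤ (m : ℝ) * (m * Real.exp (-4 * Real.sqrt (Real.log m))) := by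
        rw [mul_one]; gcongr
    _ ≤ m * rothNumberNat m := by gcongr
    _ ≤ _ := h1
end

section
/- Let q be a prime and let M ⊆ {0, 1, ..., ⌊(q-1)/2⌋} be a 2-sum-free set, i.e., the equation m_1 + m_2 = 2m_3 has no solution in M except m_1 = m_2 = m_3. Define for y ∈ Z_q and m ∈ M the triple A(y,m) = {(1,y), (2,y+m mod q), (3,y+2m mod q)}. Then the 3-uniform 3-partite hypergraph with parts V_j = {(j,y) : y ∈ Z_q} (j = 1,2,3) and edge set {A(y,m) : y ∈ Z_q, m ∈ M} is linear, has q·|M| edges, and contains no three distinct edges that pairwise intersect in three distinct vertices lying in three different parts (no triangle); consequently its edge set forms a PHF(3; q·|M|, q, 3). -/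
lemma aux_inj (q : ℕ) (hq : q.Prime) (a b : ℕ) (ha : a ≤ (q - 1) / 2) (hb : b ≤ (q - 1) / 2)
    (h : (a : ZMod q) = b) : a = b := by
  have := hq.two_le
  rw [ZMod.natCast_eq_natCast_iff] at h
  exact Nat.ModEq.eq_of_lt_of_lt h (by omega) (by omega)

lemma aux_two (q : ℕ) (hq : q.Prime) (a b c : ℕ) (ha : a ≤ (q - 1) / 2)
    (hb : b ≤ (q - 1) / 2) (hc : c ≤ (q - 1) / 2)
    (h : (a : ZMod q) + b = 2 * c) : a + b = 2 * c := by
  have := hq.two_le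
  have h' : ((a + b : ℕ) : ZMod q) = ((2 * c : ℕ) : ZMod q) := by push_cast; exact h
  rw [ZMod.natCast_eq_natCast_iff] at h'
  exact Nat.ModEq.eq_of_lt_of_lt h' (by omega) (by omega)

/-- Two edges agreeing in two parts coincide. -/
lemma aux_lin (q : ℕ) (hq : q.Prime) (p p' : ZMod q × ℕ) (hp : p.2 ≤ (q - 1) / 2)
    (hp' : p'.2 ≤ (q - 1) / 2) (j k : Fin 3) (hjk : j ≠ k)
    (h1 : p.1 + ((j : ℕ) : ZMod q) * (p.2 : ZMod q) = p'.1 + ((j : ℕ) : ZMod q) * (p'.2 : ZMod q))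
    (h2 : p.1 + ((k : ℕ) : ZMod q) * (p.2 : ZMod q) = p'.1 + ((k : ℕ) : ZMod q) * (p'.2 : ZMod q)) :
    p = p' := by
  have key : p.2 = p'.2 := by
    have h4 : (p.2 : ZMod q) = p'.2 ∨ (p.2 : ZMod q) + p.2 = 2 * p'.2 := by
      fin_cases j <;> fin_cases k <;> simp at hjk h1 h2 <;>
      first
      | (left; linear_combination h1 - h2)
      | (left; linear_combination h2 - h1)
      | (right; linear_combination h1 - h2)
      | (right; linear_combination h2 - h1)
    rcases h4 with h | h
    · exact aux_inj q hq _ _ hp hp' h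
    · have := aux_two q hq _ _ _ hp hp hp' h
      omega
  rw [key] at h1
  exact Prod.ext (add_right_cancel h1) key

/-- The triangle lemma. -/
lemma aux_tri (q : ℕ) (hq : q.Prime) (M : Finset ℕ)
    (hM : ∀ m ∈ M, m ≤ (q - 1) / 2)
    (hsf : ∀ m₁ ∈ M, ∀ m₂ ∈ M, ∀ m₃ ∈ M, m₁ + m₂ = 2 * m₃ → m₁ = m₃ ∧ m₂ = m₃)
    (X Y Z : ZMod q × ℕ) (hX : X.2 ∈ M) (hY : Y.2 ∈ M) (hZ : Z.2 ∈ M)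
    (h0 : X.1 = Y.1) (h1 : Y.1 + (Y.2 : ZMod q) = Z.1 + Z.2)
    (h2 : Z.1 + 2 * (Z.2 : ZMod q) = X.1 + 2 * X.2) : X = Y := by
  have h := aux_two q hq Y.2 Z.2 X.2 (hM _ hY) (hM _ hZ) (hM _ hX)
    (by linear_combination h0 + h1 + h2)
  exact Prod.ext h0 (hsf _ hY _ hZ _ hX h).1.symm

/-- For a prime `q` and a 2-sum-free set `M ⊆ {0, ..., ⌊(q-1)/2⌋}`, the 3-uniform
3-partite hypergraph with parts `V j = {j} × ZMod q` and edges
`A(y,m) = {(0,y), (1,y+m), (2,y+2m)}` (written as transversal functions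
`j ↦ y + j·m`) is linear, has `q·|M|` edges (the edge map is injective), contains
no rainbow triangle, and its edges form a `PHF(3; q·|M|, q, 3)`. -/
theorem stmt_15 (q : ℕ) (hq : q.Prime) (M : Finset ℕ)
    (hM : ∀ m ∈ M, m ≤ (q - 1) / 2)
    (hsf : ∀ m₁ ∈ M, ∀ m₂ ∈ M, ∀ m₃ ∈ M, m₁ + m₂ = 2 * m₃ → m₁ = m₃ ∧ m₂ = m₃) :
    ∀ A : ZMod q × ℕ → Fin 3 → ZMod q,
      (A = fun (p : ZMod q × ℕ) (j : Fin 3) => p.1 + ((j : ℕ) : ZMod q) * ((p.2 : ℕ) : ZMod q)) →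
      -- the edge map is injective, so there are exactly `q * |M|` edges
      (∀ p p' : ZMod q × ℕ, p.2 ∈ M → p'.2 ∈ M → A p = A p' → p = p') ∧
      -- the hypergraph is linear
      (∀ p p' : ZMod q × ℕ, p.2 ∈ M → p'.2 ∈ M → A p ≠ A p' →
        Set.ncard {j : Fin 3 | A p j = A p' j} ≤ 1) ∧
      -- no three distinct edges pairwise intersect in three distinct vertices
      -- lying in three different parts (no triangle)
      (¬ ∃ p₁ p₂ p₃ : ZMod q × ℕ, p₁.2 ∈ M ∧ p₂.2 ∈ M ∧ p₃.2 ∈ M ∧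
        A p₁ ≠ A p₂ ∧ A p₂ ≠ A p₃ ∧ A p₁ ≠ A p₃ ∧
        ∃ j₁ j₂ j₃ : Fin 3, j₁ ≠ j₂ ∧ j₂ ≠ j₃ ∧ j₁ ≠ j₃ ∧
          A p₁ j₁ = A p₂ j₁ ∧ A p₂ j₂ = A p₃ j₂ ∧ A p₃ j₃ = A p₁ j₃) ∧
      -- consequently, the edges form a `PHF(3; q·|M|, q, 3)`:
      -- any three distinct edges (columns) are separated by some row
      (∀ p₁ p₂ p₃ : ZMod q × ℕ, p₁.2 ∈ M → p₂.2 ∈ M → p₃.2 ∈ M →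
        A p₁ ≠ A p₂ → A p₂ ≠ A p₃ → A p₁ ≠ A p₃ →
        ∃ j : Fin 3, A p₁ j ≠ A p₂ j ∧ A p₂ j ≠ A p₃ j ∧ A p₁ j ≠ A p₃ j) := by
  rintro A rfl
  have L := aux_lin q hq
  have T := aux_tri q hq M hM hsf
  have noTri : ∀ p₁ p₂ p₃ : ZMod q × ℕ, p₁.2 ∈ M → p₂.2 ∈ M → p₃.2 ∈ M →
      p₁ ≠ p₂ → p₂ ≠ p₃ → p₁ ≠ p₃ → ∀ j₁ j₂ j₃ : Fin 3, j₁ ≠ j₂ → j₂ ≠ j₃ → j₁ ≠ j₃ →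
      p₁.1 + ((j₁ : ℕ) : ZMod q) * (p₁.2 : ZMod q) = p₂.1 + ((j₁ : ℕ) : ZMod q) * (p₂.2 : ZMod q) →
      p₂.1 + ((j₂ : ℕ) : ZMod q) * (p₂.2 : ZMod q) = p₃.1 + ((j₂ : ℕ) : ZMod q) * (p₃.2 : ZMod q) →
      p₃.1 + ((j₃ : ℕ) : ZMod q) * (p₃.2 : ZMod q) = p₁.1 + ((j₃ : ℕ) : ZMod q) * (p₁.2 : ZMod q) →
      False := by
    intro a b c ha hb hc hab hbc hac j₁ j₂ j₃ h12 h23 h13 e1 e2 e3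
    fin_cases j₁ <;> fin_cases j₂ <;> fin_cases j₃ <;> simp at h12 h23 h13 e1 e2 e3
    · exact hab (T a b c ha hb hc e1 e2 e3)
    · exact hab (T b a c hb ha hc e1.symm e3.symm e2.symm).symm
    · exact hbc (T c b a hc hb ha e2.symm e1.symm e3.symm).symm
    · exact hac (T c a b hc ha hb e3 e1 e2).symm
    · exact hbc (T b c a hb hc ha e2 e3 e1)
    · exact hac (T a c b ha hc hb e3.symm e2.symm e1.symm)
  have inj : ∀ p p' : ZMod q × ℕ, p.2 ∈ M → p'.2 ∈ M →
      ∀ j k : Fin 3, j ≠ k →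
      p.1 + ((j : ℕ) : ZMod q) * (p.2 : ZMod q) = p'.1 + ((j : ℕ) : ZMod q) * (p'.2 : ZMod q) →
      p.1 + ((k : ℕ) : ZMod q) * (p.2 : ZMod q) = p'.1 + ((k : ℕ) : ZMod q) * (p'.2 : ZMod q) →
      p = p' := fun p p' hp hp' => L p p' (hM _ hp) (hM _ hp')
  refine ⟨?_, ?_, ?_, ?_⟩
  · intro p p' hp hp' h
    exact inj p p' hp hp' 0 1 (by decide) (congrFun h 0) (congrFun h 1)
  · intro p p' hp hp' h
    rw [Set.ncard_le_one_iff]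
    intro j k hj hk
    by_contra hjk
    exact h (by rw [inj p p' hp hp' j k hjk hj hk])
  · rintro ⟨a, b, c, ha, hb, hc, hab, hbc, hac, j₁, j₂, j₃, h12, h23, h13, e1, e2, e3⟩
    exact noTri a b c ha hb hc (fun h => hab (by rw [h])) (fun h => hbc (by rw [h]))
      (fun h => hac (by rw [h])) j₁ j₂ j₃ h12 h23 h13 e1 e2 e3
  · intro a b c ha hb hc hab hbc hac
    have hab : a ≠ b := fun h => hab (by rw [h])
    have hbc : b ≠ c := fun h => hbc (by rw [h])
    have hac : a ≠ c := fun h => hac (by rw [h])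
    have nT := noTri a b c ha hb hc hab hbc hac
    have iab := fun j k hjk e1 e2 => hab (inj a b ha hb j k hjk e1 e2)
    have ibc := fun j k hjk e1 e2 => hbc (inj b c hb hc j k hjk e1 e2)
    have iac := fun j k hjk e1 e2 => hac (inj a c ha hc j k hjk e1 e2)
    by_contra hcon
    have hj : ∀ j : Fin 3,
      a.1 + ((j : ℕ) : ZMod q) * (a.2 : ZMod q) = b.1 + ((j : ℕ) : ZMod q) * (b.2 : ZMod q) ∨
      b.1 + ((j : ℕ) : ZMod q) * (b.2 : ZMod q) = c.1 + ((j : ℕ) : ZMod q) * (c.2 : ZMod q) ∨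
      a.1 + ((j : ℕ) : ZMod q) * (a.2 : ZMod q) = c.1 + ((j : ℕ) : ZMod q) * (c.2 : ZMod q) := by
      intro j
      by_contra hh
      push Not at hh
      exact hcon ⟨j, hh⟩
    have d01 : (0 : Fin 3) ≠ 1 := by decide
    have d02 : (0 : Fin 3) ≠ 2 := by decide
    have d12 : (1 : Fin 3) ≠ 2 := by decide
    rcases hj 0 with e0 | e0 | e0 <;> rcases hj 1 with e1 | e1 | e1 <;>
      first
      | exact iab _ _ d01 e0 e1
      | exact ibc _ _ d01 e0 e1
      | exact iac _ _ d01 e0 e1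
      | (rcases hj 2 with e2 | e2 | e2 <;>
        first
        | exact iab _ _ d02 e0 e2
        | exact ibc _ _ d02 e0 e2
        | exact iac _ _ d02 e0 e2
        | exact iab _ _ d12 e1 e2
        | exact ibc _ _ d12 e1 e2
        | exact iac _ _ d12 e1 e2
        | exact nT 0 1 2 d01 d12 d02 e0 e1 e2.symm
        | exact nT 0 2 1 d02 d12.symm d01 e0 e2 e1.symm
        | exact nT 1 0 2 d01.symm d02 d12 e1 e0 e2.symm
        | exact nT 1 2 0 d12 d02.symm d01.symm e1 e2 e0.symm
        | exact nT 2 0 1 d02.symm d01 d12.symm e2 e0 e1.symm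
        | exact nT 2 1 0 d12.symm d01.symm d02.symm e2 e1 e0.symm)
end

section
/- There exists a constant γ > 0 such that for all sufficiently large q, p_4(4,q) > q^2·e^{-γ(log q)^{3/4}}. -/
namespace PHFaux

/-- Raw points: two sequences of integer vectors. -/
abbrev Pt (n : ℕ) := (ℕ → Fin n → ℤ) × (ℕ → Fin n → ℤ)

/-- All quadratic invariants of the point are prescribed. -/
def Good {n : ℕ} (A B C E : ℕ → ℤ) (p : Pt n) : Prop :=
  ∀ j, p.1 j ⬝ᵥ p.1 j = A j ∧ p.2 j ⬝ᵥ p.2 j = B j ∧ p.1 j ⬝ᵥ p.2 j = C j ∧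
    p.1 (j + 1) ⬝ᵥ p.2 j = E j

/-- The four row relations. -/
def Rel {n : ℕ} (i : Fin 4) (p q : Pt n) : Prop :=
  match i with
  | 0 => ∀ j, p.1 j = q.1 j
  | 1 => ∀ j, p.2 j = q.2 j
  | 2 => ∀ j, p.1 j + p.2 j = q.1 j + q.2 j
  | 3 => p.1 0 = q.1 0 ∧ ∀ j, p.1 (j + 1) + p.2 j = q.1 (j + 1) + q.2 j

lemma Rel.symm {n : ℕ} {i : Fin 4} {p q : Pt n} (h : Rel i p q) : Rel i q p := by
  fin_cases i
  · exact fun j => (h j).symm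
  · exact fun j => (h j).symm
  · exact fun j => (h j).symm
  · exact ⟨h.1.symm, fun j => (h.2 j).symm⟩

lemma Rel.refl {n : ℕ} (i : Fin 4) (p : Pt n) : Rel i p p := by
  fin_cases i <;> simp [Rel]

lemma tri {n : ℕ} (a b c d : Fin n → ℤ) (h1 : b ⬝ᵥ b = a ⬝ᵥ a) (h2 : a ⬝ᵥ c = a ⬝ᵥ d)
    (h3 : b + c = a + d) : b = a := by
  have h4 : a ⬝ᵥ (b + c) = a ⬝ᵥ (a + d) := by rw [h3]
  have h5 : (b - a) ⬝ᵥ (b - a) = 0 := by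
    simp only [dotProduct_add, dotProduct_sub, sub_dotProduct] at h4 ⊢
    rw [dotProduct_comm b a]
    linarith
  exact sub_eq_zero.1 (dotProduct_self_eq_zero.1 h5)

lemma bottom_aux {n : ℕ} {A B C E : ℕ → ℤ} {p1 p2 p3 p4 : Pt n}
    (g1 : Good A B C E p1) (g2 : Good A B C E p2) (g4 : Good A B C E p4)
    (h12 : Rel 0 p1 p2) (h41 : Rel 3 p4 p1)
    (key : ∀ j, p4.1 j = p2.1 j → p3.1 j = p2.1 j ∧ p3.2 j = p2.2 j ∧ p4.2 j = p2.2 j) :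
    p1 = p2 ∧ p2 = p3 ∧ p3 = p4 := by
  have step : ∀ j, p4.1 j = p2.1 j → p4.1 (j + 1) = p2.1 (j + 1) ∧ p1.2 j = p2.2 j := by
    intro j hj
    obtain ⟨k1, k2, k3⟩ := key j hj
    have e1 := h41.2 j
    have e2 := h12 (j + 1)
    have t : p1.2 j = p2.2 j := by
      apply tri (p2.2 j) (p1.2 j) (p2.1 (j + 1)) (p4.1 (j + 1))
      · rw [(g1 j).2.1, (g2 j).2.1]
      · rw [dotProduct_comm, (g2 j).2.2.2, dotProduct_comm, ← k3, (g4 j).2.2.2]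
      · rw [← e2, add_comm, ← e1, k3, add_comm]
    refine ⟨?_, t⟩
    rw [k3, t, e2] at e1
    exact add_right_cancel e1
  have all : ∀ j, p4.1 j = p2.1 j := by
    intro j
    induction j with
    | zero => rw [h41.1, h12 0]
    | succ j ih => exact (step j ih).1
  refine ⟨Prod.ext (funext h12) (funext fun j => (step j (all j)).2), ?_, ?_⟩
  · exact Prod.ext (funext fun j => (key j (all j)).1.symm)
      (funext fun j => (key j (all j)).2.1.symm)
  · exact Prod.ext (funext fun j => (key j (all j)).1.trans (all j).symm)
      (funext fun j => (key j (all j)).2.1.trans (key j (all j)).2.2.symm)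

lemma bottom {n : ℕ} {A B C E : ℕ → ℤ} {p1 p2 p3 p4 : Pt n}
    (g1 : Good A B C E p1) (g2 : Good A B C E p2) (g3 : Good A B C E p3)
    (g4 : Good A B C E p4)
    (h12 : Rel 0 p1 p2) (h23 : Rel 1 p2 p3) (h34 : Rel 2 p3 p4) (h41 : Rel 3 p4 p1) :
    p1 = p2 ∧ p2 = p3 ∧ p3 = p4 := by
  apply bottom_aux g1 g2 g4 h12 h41
  intro j hj
  have e1 := h23 j
  have e2 := h34 j
  have t : p3.1 j = p2.1 j := by
    apply tri (p2.1 j) (p3.1 j) (p2.2 j) (p4.2 j)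
    · rw [(g3 j).1, (g2 j).1]
    · rw [(g2 j).2.2.1, ← hj, (g4 j).2.2.1]
    · rw [e1, e2, hj]
  refine ⟨t, e1.symm, ?_⟩
  rw [t, hj, ← e1] at e2
  exact (add_left_cancel e2).symm

lemma bottom' {n : ℕ} {A B C E : ℕ → ℤ} {p1 p2 p3 p4 : Pt n}
    (g1 : Good A B C E p1) (g2 : Good A B C E p2) (g3 : Good A B C E p3)
    (g4 : Good A B C E p4)
    (h12 : Rel 0 p1 p2) (h23 : Rel 2 p2 p3) (h34 : Rel 1 p3 p4) (h41 : Rel 3 p4 p1) :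
    p1 = p2 ∧ p2 = p3 ∧ p3 = p4 := by
  apply bottom_aux g1 g2 g4 h12 h41
  intro j hj
  have e1 := h34 j
  have e2 := h23 j
  have t : p3.1 j = p4.1 j := by
    apply tri (p4.1 j) (p3.1 j) (p4.2 j) (p2.2 j)
    · rw [(g3 j).1, (g4 j).1]
    · rw [(g4 j).2.2.1, hj, (g2 j).2.2.1]
    · rw [← e1, ← e2, hj]
  have u : p3.2 j = p2.2 j := by
    rw [t, hj] at e2
    exact (add_left_cancel e2).symm
  exact ⟨t.trans hj, u, e1.symm.trans u⟩

lemma top {n N : ℕ} {A B C E : ℕ → ℤ} {p1 p2 p3 p4 : Pt n}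
    (g1 : Good A B C E p1) (g2 : Good A B C E p2) (g3 : Good A B C E p3)
    (g4 : Good A B C E p4)
    (z3 : ∀ j, N ≤ j → p3.1 j = 0)
    (z4 : ∀ j, N ≤ j → p4.1 j = 0)
    (h12 : Rel 0 p1 p2) (h23 : Rel 1 p2 p3) (h34 : Rel 3 p3 p4) (h41 : Rel 2 p4 p1) :
    p1 = p2 ∧ p2 = p3 ∧ p3 = p4 := by
  have key : ∀ j, p4.2 j = p2.2 j →
      p1.2 j = p2.2 j ∧ p4.1 j = p2.1 j := by
    intro j hj
    have e1 := h12 j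
    have e2 := h41 j
    have t : p1.2 j = p2.2 j := by
      apply tri (p2.2 j) (p1.2 j) (p2.1 j) (p4.1 j)
      · rw [(g1 j).2.1, (g2 j).2.1]
      · rw [dotProduct_comm, (g2 j).2.2.1, dotProduct_comm, ← hj, (g4 j).2.2.1]
      · rw [← e1, add_comm, ← e2, hj, add_comm]
    refine ⟨t, ?_⟩
    rw [hj, t, e1] at e2
    exact add_right_cancel e2
  have step : ∀ j, p4.2 (j + 1) = p2.2 (j + 1) →
      p3.1 (j + 1) = p4.1 (j + 1) ∧ p4.2 j = p2.2 j := by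
    intro j hj
    obtain ⟨k1, k2⟩ := key _ hj
    have e1 := h34.2 j
    have e2 := h23 j
    have t : p3.1 (j + 1) = p4.1 (j + 1) := by
      apply tri (p4.1 (j + 1)) (p3.1 (j + 1)) (p2.2 j) (p4.2 j)
      · rw [(g3 _).1, (g4 _).1]
      · rw [(g4 j).2.2.2, k2, (g2 j).2.2.2]
      · rw [e2, e1]
    refine ⟨t, ?_⟩
    rw [t, ← e2] at e1
    exact (add_left_cancel e1).symm
  have all : ∀ i j, N ≤ j + i → p4.2 j = p2.2 j := by
    intro i
    induction i with
    | zero =>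
      intro j hj
      have e1 := h34.2 j
      rw [z3 _ (by omega), z4 _ (by omega), ← h23 j] at e1
      exact (add_left_cancel e1).symm
    | succ i ih =>
      intro j hj
      exact (step j (ih (j + 1) (by omega))).2
  have all' : ∀ j, p4.2 j = p2.2 j := fun j => all N j (by omega)
  have x3 : ∀ j, p3.1 j = p4.1 j := by
    intro j
    cases j with
    | zero => exact h34.1
    | succ j => exact (step j (all' _)).1
  refine ⟨Prod.ext (funext h12) (funext fun j => (key j (all' j)).1), ?_, ?_⟩
  · exact Prod.ext (funext fun j => ((x3 j).trans (key j (all' j)).2).symm) (funext h23)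
  · exact Prod.ext (funext x3) (funext fun j => ((all' j).trans (h23 j)).symm)

/-- No rainbow closed walk of length four, starting at row `0`. -/
lemma cyc0 {n N : ℕ} {A B C E : ℕ → ℤ} {p1 p2 p3 p4 : Pt n}
    (g1 : Good A B C E p1) (g2 : Good A B C E p2) (g3 : Good A B C E p3)
    (g4 : Good A B C E p4)
    (z1 : ∀ j, N ≤ j → p1.1 j = 0) (z2 : ∀ j, N ≤ j → p2.1 j = 0)
    (z3 : ∀ j, N ≤ j → p3.1 j = 0) (z4 : ∀ j, N ≤ j → p4.1 j = 0)
    (b c d : Fin 4) (hb : b ≠ 0) (hc : c ≠ 0) (hd : d ≠ 0) (hbc : b ≠ c) (hbd : b ≠ d)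
    (hcd : c ≠ d)
    (h12 : Rel 0 p1 p2) (h23 : Rel b p2 p3) (h34 : Rel c p3 p4) (h41 : Rel d p4 p1) :
    p1 = p2 ∧ p2 = p3 ∧ p3 = p4 := by
  have cases6 : (b = 1 ∧ c = 2 ∧ d = 3) ∨ (b = 2 ∧ c = 1 ∧ d = 3) ∨ (b = 3 ∧ c = 1 ∧ d = 2) ∨
      (b = 3 ∧ c = 2 ∧ d = 1) ∨ (b = 1 ∧ c = 3 ∧ d = 2) ∨ (b = 2 ∧ c = 3 ∧ d = 1) := by
    clear h12 h23 h34 h41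
    fin_cases b <;> fin_cases c <;> fin_cases d <;> simp_all
  have rev : p2 = p1 ∧ p1 = p4 ∧ p4 = p3 → p1 = p2 ∧ p2 = p3 ∧ p3 = p4 := by
    rintro ⟨rfl, rfl, rfl⟩; exact ⟨rfl, rfl, rfl⟩
  rcases cases6 with ⟨rfl, rfl, rfl⟩ | ⟨rfl, rfl, rfl⟩ | ⟨rfl, rfl, rfl⟩ | ⟨rfl, rfl, rfl⟩ |
    ⟨rfl, rfl, rfl⟩ | ⟨rfl, rfl, rfl⟩
  · exact bottom g1 g2 g3 g4 h12 h23 h34 h41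
  · exact bottom' g1 g2 g3 g4 h12 h23 h34 h41
  · exact rev (bottom' g2 g1 g4 g3 h12.symm h41.symm h34.symm h23.symm)
  · exact rev (bottom g2 g1 g4 g3 h12.symm h41.symm h34.symm h23.symm)
  · exact top g1 g2 g3 g4 z3 z4 h12 h23 h34 h41
  · exact rev (top g2 g1 g4 g3 z4 z3 h12.symm h41.symm h34.symm h23.symm)

/-- A family of relations without rainbow closed walks of length four. -/
def NoCyc {α : Type*} (R : Fin 4 → α → α → Prop) : Prop :=
  ∀ (a b c d : Fin 4), a ≠ b → a ≠ c → a ≠ d → b ≠ c → b ≠ d → c ≠ d →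
    ∀ p1 p2 p3 p4 : α, R a p1 p2 → R b p2 p3 → R c p3 p4 → R d p4 p1 →
      p1 = p2 ∧ p2 = p3 ∧ p3 = p4

/-- Reduction to closed walks starting with the row `0`. -/
lemma noCyc_of_zero {α : Type*} (R : Fin 4 → α → α → Prop)
    (H : ∀ (b c d : Fin 4), b ≠ 0 → c ≠ 0 → d ≠ 0 → b ≠ c → b ≠ d → c ≠ d →
      ∀ p1 p2 p3 p4 : α, R 0 p1 p2 → R b p2 p3 → R c p3 p4 → R d p4 p1 →
        p1 = p2 ∧ p2 = p3 ∧ p3 = p4) : NoCyc R := by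
  intro a b c d hab hac had hbc hbd hcd p1 p2 p3 p4 h1 h2 h3 h4
  have : a = 0 ∨ b = 0 ∨ c = 0 ∨ d = 0 := by
    clear h1 h2 h3 h4 H
    revert a b c d
    decide
  rcases this with rfl | rfl | rfl | rfl
  · exact H b c d hab.symm hac.symm had.symm hbc hbd hcd p1 p2 p3 p4 h1 h2 h3 h4
  · obtain ⟨rfl, rfl, rfl⟩ := H c d a hbc.symm hbd.symm hab hcd hac.symm had.symm
      p2 p3 p4 p1 h2 h3 h4 h1
    exact ⟨rfl, rfl, rfl⟩
  · obtain ⟨rfl, rfl, rfl⟩ := H d a b hcd.symm hac hbc had.symm hbd.symm hab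
      p3 p4 p1 p2 h3 h4 h1 h2
    exact ⟨rfl, rfl, rfl⟩
  · obtain ⟨rfl, rfl, rfl⟩ := H a b c had hbd hcd hab hac hbc
      p4 p1 p2 p3 h4 h1 h2 h3
    exact ⟨rfl, rfl, rfl⟩

/-- The six pairs of elements of `Fin 4`. -/
def pr (k : Fin 6) : Fin 4 × Fin 4 :=
  match k with
  | 0 => (0, 1)
  | 1 => (0, 2)
  | 2 => (0, 3)
  | 3 => (1, 2)
  | 4 => (1, 3)
  | 5 => (2, 3)

lemma pr_surj : ∀ a b : Fin 4, a ≠ b → ∃ k, pr k = (a, b) ∨ pr k = (b, a) := by decide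

lemma sub_cases : ∀ S : Finset (Fin 6), S.card = 4 →
    (0 ∈ S ∧ 3 ∈ S ∧ 1 ∈ S) ∨ (0 ∈ S ∧ 4 ∈ S ∧ 2 ∈ S) ∨ (1 ∈ S ∧ 5 ∈ S ∧ 2 ∈ S) ∨
    (3 ∈ S ∧ 5 ∈ S ∧ 4 ∈ S) ∨ (0 ∈ S ∧ 3 ∈ S ∧ 5 ∈ S ∧ 2 ∈ S) ∨
    (0 ∈ S ∧ 4 ∈ S ∧ 5 ∈ S ∧ 1 ∈ S) ∨ (1 ∈ S ∧ 3 ∈ S ∧ 4 ∈ S ∧ 2 ∈ S) := by decide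

lemma fourth : ∀ a b c : Fin 4, ∃ d, a ≠ d ∧ b ≠ d ∧ c ≠ d := by decide

lemma comb {α : Type*} {R : Fin 4 → α → α → Prop} (hR : NoCyc R)
    (hr : ∀ i p, R i p p) (hs : ∀ i p q, R i p q → R i q p)
    (v : Fin 4 → α) (hv : Function.Injective v) :
    ∃ i, ∀ a b, R i (v a) (v b) → a = b := by
  by_contra! hcon
  have h1 : ∀ i, ∃ k, R i (v (pr k).1) (v (pr k).2) := by
    intro i
    obtain ⟨a, b, hab, hne⟩ := hcon i
    obtain ⟨k, hk | hk⟩ := pr_surj a b hne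
    · exact ⟨k, by rw [hk]; exact hab⟩
    · exact ⟨k, by rw [hk]; exact hs _ _ _ hab⟩
  choose e he using h1
  have prne : ∀ k, (pr k).1 ≠ (pr k).2 := by decide
  have hinj : Function.Injective e := by
    intro i j hij
    by_contra hne
    obtain ⟨c, hc1, hc2, -⟩ := fourth i j j
    obtain ⟨d, hd1, hd2, hd3⟩ := fourth i j c
    have := hR i j c d hne hc1 hd1 hc2 hd2 hd3 _ _ _ _ (he i)
      (by rw [hij]; exact hs _ _ _ (he j)) (hr c _) (hr d _)
    exact prne _ (hv this.1)
  have hcard : (Finset.univ.image e).card = 4 := by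
    rw [Finset.card_image_of_injective _ hinj]; simp
  have T : ∀ k1 k2 k3 : Fin 6, ∀ x y z : Fin 4, k1 ≠ k2 → k1 ≠ k3 → k2 ≠ k3 → x ≠ y →
      pr k1 = (x, y) → pr k2 = (y, z) → pr k3 = (x, z) →
      k1 ∈ Finset.univ.image e → k2 ∈ Finset.univ.image e → k3 ∈ Finset.univ.image e →
      False := by
    intro k1 k2 k3 x y z n12 n13 n23 hxy q1 q2 q3 m1 m2 m3
    simp only [Finset.mem_image, Finset.mem_univ, true_and] at m1 m2 m3
    obtain ⟨i1, rfl⟩ := m1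
    obtain ⟨i2, rfl⟩ := m2
    obtain ⟨i3, rfl⟩ := m3
    obtain ⟨d, hd1, hd2, hd3⟩ := fourth i1 i2 i3
    have r1 := he i1
    have r2 := he i2
    have r3 := he i3
    rw [q1] at r1
    rw [q2] at r2
    rw [q3] at r3
    have := hR i1 i2 i3 d (fun h => n12 (by rw [h])) (fun h => n13 (by rw [h])) hd1
      (fun h => n23 (by rw [h])) hd2 hd3 _ _ _ _ r1 r2 (hs _ _ _ r3) (hr d _)
    exact hxy (hv this.1)
  have Q : ∀ k1 k2 k3 k4 : Fin 6, ∀ x y z w : Fin 4, k1 ≠ k2 → k1 ≠ k3 → k1 ≠ k4 →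
      k2 ≠ k3 → k2 ≠ k4 → k3 ≠ k4 → x ≠ y →
      pr k1 = (x, y) → (pr k2 = (y, z) ∨ pr k2 = (z, y)) →
      (pr k3 = (z, w) ∨ pr k3 = (w, z)) → pr k4 = (x, w) →
      k1 ∈ Finset.univ.image e → k2 ∈ Finset.univ.image e → k3 ∈ Finset.univ.image e →
      k4 ∈ Finset.univ.image e → False := by
    intro k1 k2 k3 k4 x y z w n12 n13 n14 n23 n24 n34 hxy q1 q2 q3 q4 m1 m2 m3 m4
    simp only [Finset.mem_image, Finset.mem_univ, true_and] at m1 m2 m3 m4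
    obtain ⟨i1, rfl⟩ := m1
    obtain ⟨i2, rfl⟩ := m2
    obtain ⟨i3, rfl⟩ := m3
    obtain ⟨i4, rfl⟩ := m4
    have r1 := he i1
    have r4 := he i4
    rw [q1] at r1
    rw [q4] at r4
    have r2 : R i2 (v y) (v z) := by
      have := he i2
      rcases q2 with q | q <;> rw [q] at this
      · exact this
      · exact hs _ _ _ this
    have r3 : R i3 (v z) (v w) := by
      have := he i3
      rcases q3 with q | q <;> rw [q] at this
      · exact this
      · exact hs _ _ _ this
    have := hR i1 i2 i3 i4 (fun h => n12 (by rw [h])) (fun h => n13 (by rw [h]))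
      (fun h => n14 (by rw [h])) (fun h => n23 (by rw [h])) (fun h => n24 (by rw [h]))
      (fun h => n34 (by rw [h])) _ _ _ _ r1 r2 r3 (hs _ _ _ r4)
    exact hxy (hv this.1)
  rcases sub_cases _ hcard with ⟨a, b, c⟩ | ⟨a, b, c⟩ | ⟨a, b, c⟩ | ⟨a, b, c⟩ |
    ⟨a, b, c, d⟩ | ⟨a, b, c, d⟩ | ⟨a, b, c, d⟩
  · exact T 0 3 1 0 1 2 (by decide) (by decide) (by decide) (by decide) rfl rfl rfl a b c
  · exact T 0 4 2 0 1 3 (by decide) (by decide) (by decide) (by decide) rfl rfl rfl a b c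
  · exact T 1 5 2 0 2 3 (by decide) (by decide) (by decide) (by decide) rfl rfl rfl a b c
  · exact T 3 5 4 1 2 3 (by decide) (by decide) (by decide) (by decide) rfl rfl rfl a b c
  · exact Q 0 3 5 2 0 1 2 3 (by decide) (by decide) (by decide) (by decide) (by decide)
      (by decide) (by decide) rfl (by decide) (by decide) rfl a b c d
  · exact Q 0 4 5 1 0 1 3 2 (by decide) (by decide) (by decide) (by decide) (by decide)
      (by decide) (by decide) rfl (by decide) (by decide) rfl a b c d
  · exact Q 1 3 4 2 0 2 1 3 (by decide) (by decide) (by decide) (by decide) (by decide)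
      (by decide) (by decide) rfl (by decide) (by decide) rfl a b c d

lemma bdd (q : ℕ) : BddAbove {n | ∃ M : Fin 4 → Fin n → Fin q, IsPHFMat 4 n q 4 M} := by
  refine ⟨q ^ 4, ?_⟩
  rintro n ⟨M, hM, -⟩
  have : Function.Injective (fun (x : Fin n) (i : Fin 4) => M i x) := by
    intro x y h
    exact hM x y (fun i => congrFun h i)
  have := Fintype.card_le_of_injective _ this
  simpa using this

lemma card_le_pPHF {α β : Type*} [Fintype α] [Fintype β] (q : ℕ) (hq : Fintype.card β ≤ q)
    (f : Fin 4 → α → β) (hf : NoCyc (fun i p r => f i p = f i r)) :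
    Fintype.card α ≤ pPHF 4 4 q := by
  apply le_csSup (bdd q)
  let eα := (Fintype.equivFin α).symm
  let g : β → Fin q := fun b => Fin.castLE hq (Fintype.equivFin β b)
  have hg : Function.Injective g :=
    (Fin.castLE_injective hq).comp (Fintype.equivFin β).injective
  refine ⟨fun i x => g (f i (eα x)), ?_, ?_⟩
  · intro x y h
    have h' : ∀ i, f i (eα x) = f i (eα y) := fun i => hg (h i)
    have := hf 0 1 2 3 (by decide) (by decide) (by decide) (by decide) (by decide) (by decide)
      (eα x) (eα y) (eα x) (eα y) (h' 0) (h' 1).symm (h' 2) (h' 3).symm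
    exact eα.injective this.1
  · intro S hS
    let w := S.equivFin.symm
    obtain ⟨i, hi⟩ := comb hf (fun _ _ => rfl) (fun _ _ _ h => h.symm)
      (fun a : Fin 4 => eα (w (Fin.cast hS.symm a))) (by
        intro a b hab
        simpa using hab)
    refine ⟨i, ?_⟩
    intro x hx y hy hxy
    have := hi (Fin.cast hS (S.equivFin ⟨x, hx⟩)) (Fin.cast hS (S.equivFin ⟨y, hy⟩)) (by
      simpa [w] using hg hxy)
    simpa using this

/-- Digit arrays. -/
abbrev Dig (n : ℕ) := Fin n → Fin n → Fin (2 ^ n)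

/-- Extension of a digit array by zero. -/
def ext {n : ℕ} (x : Dig n) (j : ℕ) (c : Fin n) : ℕ :=
  if h : j < n then (x ⟨j, h⟩ c : ℕ) else 0

lemma ext_lt {n : ℕ} (x : Dig n) (j : ℕ) (c : Fin n) : ext x j c < 2 ^ n := by
  unfold ext
  split_ifs
  · exact Fin.is_lt _
  · positivity

lemma ext_ge {n : ℕ} (x : Dig n) (j : ℕ) (hj : n ≤ j) (c : Fin n) : ext x j c = 0 := by
  unfold ext
  rw [dif_neg (by omega)]

lemma ext_inj {n : ℕ} {x y : Dig n} (h : ∀ j c, ext x j c = ext y j c) : x = y := by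
  funext j c
  have := h j c
  simp only [ext, j.is_lt, dif_pos] at this
  exact Fin.ext this

/-- Raw point of a pair of digit arrays. -/
def toPt {n : ℕ} (p : Dig n × Dig n) : Pt n :=
  (fun j c => (ext p.1 j c : ℤ), fun j c => (ext p.2 j c : ℤ))

lemma toPt_inj {n : ℕ} : Function.Injective (toPt (n := n)) := by
  intro p q h
  apply Prod.ext
  · apply ext_inj
    intro j c
    have := congrFun (congrFun (congrArg Prod.fst h) j) c
    simpa [toPt] using this
  · apply ext_inj
    intro j c
    have := congrFun (congrFun (congrArg Prod.snd h) j) c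
    simpa [toPt] using this

/-- Digits of the rows. -/
def val {n : ℕ} (i : Fin 4) (p : Dig n × Dig n) (j : ℕ) (c : Fin n) : ℕ :=
  match i with
  | 0 => ext p.1 j c
  | 1 => ext p.2 j c
  | 2 => ext p.1 j c + ext p.2 j c
  | 3 => ext p.1 j c + (match j with
    | 0 => 0
    | j + 1 => ext p.2 j c)

lemma val_lt {n : ℕ} (i : Fin 4) (p : Dig n × Dig n) (j : ℕ) (c : Fin n) :
    val i p j c < 2 ^ (n + 1) := by
  have h : 2 ^ (n + 1) = 2 ^ n + 2 ^ n := by ring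
  have h1 := ext_lt p.1 j c
  have h2 := ext_lt p.2 j c
  fin_cases i
  · simp only [val]; omega
  · simp only [val]; omega
  · simp only [val]; omega
  · cases j with
    | zero => simp only [val]; omega
    | succ j =>
      have h3 := ext_lt p.2 j c
      simp only [val]; omega

lemma val_ge {n : ℕ} (i : Fin 4) (p : Dig n × Dig n) (j : ℕ) (hj : n < j) (c : Fin n) :
    val i p j c = 0 := by
  have h1 := ext_ge p.1 j hj.le c
  have h2 := ext_ge p.2 j hj.le c
  fin_cases i
  · simp only [val, h1]
  · simp only [val, h2]
  · simp only [val, h1, h2]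
  · cases j with
    | zero => omega
    | succ j =>
      have h3 := ext_ge p.2 j (by omega) c
      simp only [val, h1, h3]

/-- The rows. -/
def row {n : ℕ} (i : Fin 4) (p : Dig n × Dig n) : Fin (n + 1) → Fin n → Fin (2 ^ (n + 1)) :=
  fun j c => ⟨val i p j c, val_lt i p j c⟩

lemma rel_of_row {n : ℕ} {i : Fin 4} {p q : Dig n × Dig n} (h : row i p = row i q) :
    Rel i (toPt p) (toPt q) := by
  have h' : ∀ j c, val i p j c = val i q j c := by
    intro j c
    by_cases hj : j < n + 1
    · have := congrFun (congrFun h ⟨j, hj⟩) c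
      simpa [row] using this
    · rw [val_ge _ _ _ (by omega), val_ge _ _ _ (by omega)]
  fin_cases i
  · intro j
    funext c
    have := h' j c
    simp only [val] at this
    simp [toPt, this]
  · intro j
    funext c
    have := h' j c
    simp only [val] at this
    simp [toPt, this]
  · intro j
    funext c
    have := h' j c
    simp only [val] at this
    simp only [toPt, Pi.add_apply]
    exact_mod_cast this
  · refine ⟨?_, ?_⟩
    · funext c
      have := h' 0 c
      simp only [val, add_zero] at this
      simp [toPt, this]
    · intro j
      funext c
      have := h' (j + 1) c
      simp only [val] at this
      simp only [toPt, Pi.add_apply]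
      exact_mod_cast this

/-- The quadratic invariants. -/
def quad {n : ℕ} (p : Dig n × Dig n) (j : ℕ) (i : Fin 4) : ℕ :=
  match i with
  | 0 => ∑ c, ext p.1 j c * ext p.1 j c
  | 1 => ∑ c, ext p.2 j c * ext p.2 j c
  | 2 => ∑ c, ext p.1 j c * ext p.2 j c
  | 3 => ∑ c, ext p.1 (j + 1) c * ext p.2 j c

lemma sum_lt {n : ℕ} (x y : Dig n) (j k : ℕ) :
    ∑ c, ext x j c * ext y k c < 2 ^ (3 * n) := by
  have h : ∑ c, ext x j c * ext y k c ≤ ∑ _c : Fin n, 2 ^ n * 2 ^ n :=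
    Finset.sum_le_sum fun c _ => Nat.mul_le_mul (ext_lt x j c).le (ext_lt y k c).le
  refine h.trans_lt ?_
  rw [Finset.sum_const, Finset.card_univ, Fintype.card_fin, smul_eq_mul]
  have e : 2 ^ (3 * n) = 2 ^ n * (2 ^ n * 2 ^ n) := by rw [← pow_add, ← pow_add]; congr 1; ring
  rw [e]
  exact Nat.mul_lt_mul_of_pos_right Nat.lt_two_pow_self (by positivity)

lemma quad_lt {n : ℕ} (p : Dig n × Dig n) (j : ℕ) (i : Fin 4) : quad p j i < 2 ^ (3 * n) := by
  fin_cases i <;> exact sum_lt _ _ _ _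

lemma quad_ge {n : ℕ} (p : Dig n × Dig n) (j : ℕ) (hj : n ≤ j) (i : Fin 4) :
    quad p j i = 0 := by
  fin_cases i
  · simp [quad, ext_ge p.1 j hj]
  · simp [quad, ext_ge p.2 j hj]
  · simp [quad, ext_ge p.1 j hj]
  · simp [quad, ext_ge p.2 j hj]

/-- The invariant as an element of a finite type. -/
def inv {n : ℕ} (p : Dig n × Dig n) : Fin n → Fin 4 → Fin (2 ^ (3 * n)) :=
  fun j i => ⟨quad p j i, quad_lt p j i⟩

lemma good_of_inv {n : ℕ} {p r : Dig n × Dig n} (h : inv p = inv r) :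
    Good (fun j => (quad r j 0 : ℤ)) (fun j => (quad r j 1 : ℤ)) (fun j => (quad r j 2 : ℤ))
      (fun j => (quad r j 3 : ℤ)) (toPt p) := by
  have h' : ∀ j i, quad p j i = quad r j i := by
    intro j i
    by_cases hj : j < n
    · have := congrFun (congrFun h ⟨j, hj⟩) i
      simpa [inv] using this
    · rw [quad_ge _ _ (by omega), quad_ge _ _ (by omega)]
  intro j
  simp only [← h']
  refine ⟨?_, ?_, ?_, ?_⟩ <;> simp [toPt, quad, dotProduct]

lemma zero_toPt {n : ℕ} (p : Dig n × Dig n) (j : ℕ) (hj : n ≤ j) : (toPt p).1 j = 0 := by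
  funext c
  simp [toPt, ext_ge p.1 j hj c]

lemma main_lower (n q : ℕ) (hn : 6 ≤ n) (hq : 2 ^ (n * (n + 1) ^ 2) ≤ q) :
    2 ^ (2 * n ^ 3 - 12 * n ^ 2) ≤ pPHF 4 4 q := by
  classical
  obtain ⟨y, hy⟩ := Fintype.exists_le_card_fiber_of_mul_le_card (α := Dig n × Dig n)
    (β := Fin n → Fin 4 → Fin (2 ^ (3 * n))) inv (n := 2 ^ (2 * n ^ 3 - 12 * n ^ 2)) (by
      simp only [Fintype.card_prod, Fintype.card_pi, Fintype.card_fin, Finset.prod_const,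
        Finset.card_univ, ← pow_mul, ← pow_add]
      apply Nat.pow_le_pow_right (by norm_num)
      have : 12 * n ^ 2 ≤ 2 * n ^ 3 := by nlinarith [sq_nonneg n]
      have e1 : 3 * n * 4 * n = 12 * n ^ 2 := by ring
      have e2 : n * n * n = n ^ 3 := by ring
      rw [e1, e2]
      omega)
  refine hy.trans ?_
  rw [← Fintype.card_subtype]
  refine card_le_pPHF (α := {p : Dig n × Dig n // inv p = y})
    (β := Fin (n + 1) → Fin n → Fin (2 ^ (n + 1))) q ?_ (fun i p => row i p.1) ?_
  · refine le_trans (le_of_eq ?_) hq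
    simp only [Fintype.card_pi, Fintype.card_fin, Finset.prod_const, Finset.card_univ, ← pow_mul]
    congr 1
    ring
  · apply noCyc_of_zero
    intro b c d hb hc hd hbc hbd hcd p1 p2 p3 p4 h1 h2 h3 h4
    have g : ∀ p : {p : Dig n × Dig n // inv p = y}, inv p.1 = inv p1.1 := fun p =>
      p.2.trans p1.2.symm
    have := cyc0 (N := n) (good_of_inv (g p1)) (good_of_inv (g p2)) (good_of_inv (g p3))
      (good_of_inv (g p4)) (zero_toPt _) (zero_toPt _) (zero_toPt _) (zero_toPt _)
      b c d hb hc hd hbc hbd hcd (rel_of_row h1) (rel_of_row h2) (rel_of_row h3) (rel_of_row h4)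
    exact ⟨Subtype.ext (toPt_inj this.1), Subtype.ext (toPt_inj this.2.1),
      Subtype.ext (toPt_inj this.2.2)⟩

lemma exists_n (q : ℕ) (hq : 2 ^ (6 * (6 + 1) ^ 2) ≤ q) :
    ∃ n, 6 ≤ n ∧ 2 ^ (n * (n + 1) ^ 2) ≤ q ∧ q < 2 ^ ((n + 1) * (n + 2) ^ 2) := by
  classical
  let P : ℕ → Prop := fun n => q < 2 ^ ((n + 1) * (n + 2) ^ 2)
  have hP : ∃ n, P n := ⟨q, by
    refine lt_of_lt_of_le Nat.lt_two_pow_self (Nat.pow_le_pow_right (by norm_num) ?_)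
    nlinarith [sq_nonneg q]⟩
  have hge : ∀ n, n < 6 → ¬ P n := by
    intro n hn h
    have : 2 ^ ((n + 1) * (n + 2) ^ 2) ≤ 2 ^ (6 * (6 + 1) ^ 2) := by
      apply Nat.pow_le_pow_right (by norm_num)
      exact Nat.mul_le_mul (by omega) (Nat.pow_le_pow_left (by omega) 2)
    exact absurd h (not_lt.2 (this.trans hq))
  refine ⟨Nat.find hP, ?_, ?_, Nat.find_spec hP⟩
  · by_contra h
    exact hge _ (not_le.1 h) (Nat.find_spec hP)
  · have h6 : 6 ≤ Nat.find hP := by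
      by_contra h
      exact hge _ (not_le.1 h) (Nat.find_spec hP)
    obtain ⟨m, hm⟩ : ∃ m, Nat.find hP = m + 1 := ⟨Nat.find hP - 1, by omega⟩
    have := Nat.find_min hP (m := m) (by omega)
    rw [hm]
    exact not_lt.1 this

end PHFaux

theorem stmt_18 :
    ∃ γ : ℝ, 0 < γ ∧ ∃ q₀ : ℕ, ∀ q : ℕ, q₀ ≤ q →
      (q : ℝ) ^ 2 * Real.exp (-γ * (Real.log q) ^ ((3 : ℝ) / 4)) < (pPHF 4 4 q : ℝ) := by
  refine ⟨46, by norm_num, 2 ^ (6 * (6 + 1) ^ 2), ?_⟩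
  intro q hq0
  obtain ⟨n, hn, hq1, hq2⟩ := PHFaux.exists_n q hq0
  clear hq0
  have hlow := PHFaux.main_lower n q hn hq1
  have hn1 : (1 : ℝ) ≤ n := by exact_mod_cast (show 1 ≤ n by omega)
  have hl0 : 0 < Real.log 2 := Real.log_pos (by norm_num)
  have hl1 : Real.log 2 ≤ 1 := by
    have := Real.log_two_lt_d9
    linarith
  -- lower bound for the logarithm
  have hlog : (n : ℝ) ^ 3 * Real.log 2 ≤ Real.log q := by
    have h1 : ((2 : ℝ) ^ (n ^ 3)) ≤ q := by
      have : 2 ^ (n ^ 3) ≤ q := by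
        refine le_trans (Nat.pow_le_pow_right (by norm_num) ?_) hq1
        nlinarith [sq_nonneg n]
      exact_mod_cast this
    have h2 := Real.log_le_log (by positivity) h1
    rw [Real.log_pow] at h2
    exact_mod_cast h2
  have hpow : (n : ℝ) ^ 2 * Real.log 2 ≤ (Real.log q) ^ ((3 : ℝ) / 4) := by
    have h1 : ((n : ℝ) ^ 3 * Real.log 2) ^ ((3 : ℝ) / 4) ≤ (Real.log q) ^ ((3 : ℝ) / 4) :=
      Real.rpow_le_rpow (by positivity) hlog (by norm_num)
    refine le_trans ?_ h1
    rw [Real.mul_rpow (by positivity) hl0.le, ← Real.rpow_natCast, ← Real.rpow_natCast,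
      ← Real.rpow_mul (by positivity)]
    apply mul_le_mul _ _ hl0.le (by positivity)
    · exact Real.rpow_le_rpow_of_exponent_le hn1 (by norm_num)
    · calc Real.log 2 = (Real.log 2) ^ (1 : ℝ) := (Real.rpow_one _).symm
        _ ≤ _ := Real.rpow_le_rpow_of_exponent_ge hl0 hl1 (by norm_num)
  have hexp : Real.exp (-46 * (Real.log q) ^ ((3 : ℝ) / 4)) ≤ ((2 : ℝ) ^ (46 * n ^ 2))⁻¹ := by
    have : ((2 : ℝ) ^ (46 * n ^ 2))⁻¹ = Real.exp (-(46 * n ^ 2 * Real.log 2)) := by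
      rw [Real.exp_neg]
      congr 1
      rw [← Real.exp_log (show (0 : ℝ) < 2 ^ (46 * n ^ 2) by positivity), Real.log_pow]
      push_cast
      rfl
    rw [this]
    apply Real.exp_le_exp.2
    nlinarith
  have hqq : (q : ℝ) ^ 2 < 2 ^ (2 * ((n + 1) * (n + 2) ^ 2)) := by
    have h1 : (q : ℝ) < 2 ^ ((n + 1) * (n + 2) ^ 2) := by exact_mod_cast hq2
    rw [mul_comm 2, pow_mul]
    exact pow_lt_pow_left₀ h1 (by positivity) (by norm_num)
  have hle : 2 * ((n + 1) * (n + 2) ^ 2) ≤ (2 * n ^ 3 - 12 * n ^ 2) + 46 * n ^ 2 := by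
    have h1 : 12 * n ^ 2 ≤ 2 * n ^ 3 := by nlinarith [sq_nonneg n]
    have h2 : 2 * ((n + 1) * (n + 2) ^ 2) + 12 * n ^ 2 ≤ 2 * n ^ 3 + 46 * n ^ 2 := by nlinarith
    omega
  calc (q : ℝ) ^ 2 * Real.exp (-46 * (Real.log q) ^ ((3 : ℝ) / 4))
      ≤ (q : ℝ) ^ 2 * ((2 : ℝ) ^ (46 * n ^ 2))⁻¹ :=
        mul_le_mul_of_nonneg_left hexp (by positivity)
    _ < 2 ^ (2 * ((n + 1) * (n + 2) ^ 2)) * ((2 : ℝ) ^ (46 * n ^ 2))⁻¹ :=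
        mul_lt_mul_of_pos_right hqq (by positivity)
    _ ≤ 2 ^ (2 * n ^ 3 - 12 * n ^ 2) := by
        rw [mul_inv_le_iff₀ (by positivity), ← pow_add]
        exact pow_le_pow_right₀ (by norm_num) hle
    _ ≤ (pPHF 4 4 q : ℝ) := by exact_mod_cast hlow
end
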